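/- arXiv:2312.16590 — 7 statements merged into one kernel-verified Lean document; each statement's English description precedes it below -/
import Mathlib

section
/- Let d ≥ 1 and ℓ ≥ 2 be natural numbers. Let B ⊆ Δ_ℓ(d) be a basepoint-free and concise subset with at least two elements, and suppose B is collinear: there exist g ∈ ℤ^{ℓ+1} with ⟨B⟩ = ℤ·g, elements v, w ∈ B and an integer d′ ≥ 1 with w = v + d′·g, such that every element of B equals v + k·g for some integer 0 ≤ k ≤ d′. Then d′ < d. (This is the combinatorial content of the statement that an imprimitive Cayley structure of degree d and length ℓ > 1 has reduction of degree strictly less than d.) -/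
/-- `Delta n d` is the set Δ(d) of integer vectors in `ℤ^n` with nonnegative
entries summing to `d`.  (For the paper's Δ_ℓ(d) take `n = ℓ + 1`.) -/
def Delta (n d : ℕ) : Set (Fin n → ℤ) :=
  {u | (∀ i, 0 ≤ u i) ∧ ∑ i, u i = (d : ℤ)}

/-- A subset `B ⊆ ℤ^n` is basepoint-free if for every index `i` there is
`v ∈ B` with `v i = 0`. -/
def Basepointfree {n : ℕ} (B : Set (Fin n → ℤ)) : Prop :=
  ∀ i, ∃ v ∈ B, v i = 0

/-- A subset `B ⊆ ℤ^n` is concise if for every index `i` there is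
`v ∈ B` with `v i ≠ 0`. -/
def Concise {n : ℕ} (B : Set (Fin n → ℤ)) : Prop :=
  ∀ i, ∃ v ∈ B, v i ≠ 0

/-- `latticeOf B` is the subgroup ⟨B⟩ of `ℤ^n` generated by all differences
of elements of `B`. -/
def latticeOf {n : ℕ} (B : Set (Fin n → ℤ)) : AddSubgroup (Fin n → ℤ) :=
  AddSubgroup.closure {x | ∃ v ∈ B, ∃ w ∈ B, x = v - w}

/-- If an affine function `k ↦ a + k * c` is nonnegative at `0` and `m`, vanishes at some integer
of `[0, m]` and is not identically zero, then its values at `0` and `m` have sum at least `m`. -/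
lemma le_add_endpoints_of_zero_of_ne_zero {a c m k k' : ℤ} (h0 : 0 ≤ a) (hm : 0 ≤ a + m * c)
    (hk0 : 0 ≤ k) (hkm : k ≤ m) (hk : a + k * c = 0) (hk' : a + k' * c ≠ 0) :
    m ≤ a + (a + m * c) := by
  rcases lt_trichotomy c 0 with hc | rfl | hc
  · nlinarith
  · simp_all
  · nlinarith

theorem statement_2 (d ℓ : ℕ) (hd : 1 ≤ d) (hl : 2 ≤ ℓ)
    (B : Set (Fin (ℓ + 1) → ℤ))
    (hBΔ : B ⊆ Delta (ℓ + 1) d)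
    (hbpf : Basepointfree B)
    (hconc : Concise B)
    (hcard : B.Nontrivial)
    (g : Fin (ℓ + 1) → ℤ)
    (hgen : latticeOf B = AddSubgroup.closure {g})
    (v w : Fin (ℓ + 1) → ℤ) (hv : v ∈ B) (hw : w ∈ B)
    (d' : ℤ) (hd' : 1 ≤ d') (hvw : w = v + d' • g)
    (hcol : ∀ u ∈ B, ∃ k : ℤ, 0 ≤ k ∧ k ≤ d' ∧ u = v + k • g) :
    d' < (d : ℤ) := by
  have hle : ∀ i, d' ≤ v i + w i := by
    intro i
    obtain ⟨x, hx, hxi⟩ := hbpf i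
    obtain ⟨y, hy, hyi⟩ := hconc i
    obtain ⟨k, hk0, hkd, rfl⟩ := hcol x hx
    obtain ⟨k', -, -, rfl⟩ := hcol y hy
    have hwi := (hBΔ hw).1 i
    subst hvw
    simp only [Pi.add_apply, Pi.smul_apply, smul_eq_mul] at hxi hyi hwi ⊢
    exact le_add_endpoints_of_zero_of_ne_zero ((hBΔ hv).1 i) hwi hk0 hkd hxi hyi
  have hsum : ∑ _i : Fin (ℓ + 1), d' ≤ ∑ i, (v i + w i) := Finset.sum_le_sum fun i _ => hle i
  rw [Finset.sum_add_distrib, (hBΔ hv).2, (hBΔ hw).2] at hsum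
  simp only [Finset.sum_const, Finset.card_univ, Fintype.card_fin, nsmul_eq_mul, Nat.cast_add,
    Nat.cast_one] at hsum
  have hl' : (2 : ℤ) ≤ ℓ := by exact_mod_cast hl
  nlinarith
end

section
/- Let K be a field, let d ≥ 1 and ℓ ≥ 0 be natural numbers, and fix an index i ∈ {0,…,ℓ}. Let B ⊆ Δ_ℓ(d) be basepoint-free. Let (a_j)_{j≠i} be pairwise distinct elements of K such that for all distinct v, v′ ∈ B with v_i = v′_i = 0 one has ∑_{j≠i} a_j (v_j − v′_j) ≠ 0. Set f_i = y_1 and f_j = y_0 − a_j y_1 for j ≠ i. Then the following are equivalent: (a) there exists λ ∈ K such that for every v ∈ B, λ·(coefficient of y_0^d in f^v) + (coefficient of y_0^{d−1} y_1 in f^v) = 0; (b) no v ∈ B has v_i = 1, and there is exactly one v ∈ B with v_i = 0. (Geometrically: the center of the projection defining the rational curve C_{B,f} meets the tangent line of the rational normal curve at the marked point P_i if and only if B is cuspidal at i.) -/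
/-- Given linear forms `f i` in the two variables `y₀ = X 0`, `y₁ = X 1` and an
exponent vector `v` with nonnegative entries, `fpow f v = ∏ i, (f i)^(v i)`. -/
noncomputable def fpow {K : Type*} [CommRing K] {n : ℕ}
    (f : Fin n → MvPolynomial (Fin 2) K) (v : Fin n → ℤ) : MvPolynomial (Fin 2) K :=
  ∏ i, (f i) ^ (v i).toNat

/-- The coefficient of the monomial `y₀^p * y₁^q` in a polynomial in two variables. -/
noncomputable def coeffMon {K : Type*} [CommRing K] (p q : ℕ)
    (P : MvPolynomial (Fin 2) K) : K :=
  MvPolynomial.coeff (Finsupp.single (0 : Fin 2) p + Finsupp.single (1 : Fin 2) q) P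

open MvPolynomial in
/-- A product of linear forms `y₀ - a j * y₁`, multiplied by `y₀`, agrees modulo `y₁ ^ 2` with
its two leading terms. -/
theorem exists_prod_X_sub_C_mul_X_pow_mul_X {K ι : Type*} [CommRing K] (s : Finset ι)
    (a : ι → K) (m : ι → ℕ) :
    ∃ Q : MvPolynomial (Fin 2) K,
      (∏ j ∈ s, (X 0 - C (a j) * X 1) ^ m j) * X 0 =
        X 0 ^ (∑ j ∈ s, m j + 1) - C (∑ j ∈ s, a j * m j) * X 0 ^ (∑ j ∈ s, m j) * X 1
          + X 1 ^ 2 * Q := by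
  classical
  have key (b : K) (k : ℕ) (N : ℕ) (c : K) (Q : MvPolynomial (Fin 2) K) :
      ∃ Q' : MvPolynomial (Fin 2) K,
        (X 0 - C b * X 1) ^ k * (X 0 ^ (N + 1) - C c * X 0 ^ N * X 1 + X 1 ^ 2 * Q) =
          X 0 ^ (k + N + 1) - C (b * k + c) * X 0 ^ (k + N) * X 1 + X 1 ^ 2 * Q' := by
    induction k with
    | zero => exact ⟨Q, by simp⟩
    | succ k ih =>
      obtain ⟨Q', hQ'⟩ := ih
      refine ⟨X 0 * Q' + C b * C (b * k + c) * X 0 ^ (k + N) - C b * X 1 * Q', ?_⟩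
      rw [pow_succ', mul_assoc, hQ']
      simp only [Nat.cast_add, Nat.cast_one, C_add, C_mul, C_1]
      ring
  induction s using Finset.induction_on with
  | empty => exact ⟨0, by simp⟩
  | insert j s hj ih =>
    obtain ⟨Q, hQ⟩ := ih
    rw [Finset.prod_insert hj, Finset.sum_insert hj, Finset.sum_insert hj, mul_assoc, hQ]
    exact key _ _ _ _ _

open MvPolynomial in
theorem coeffMon_eq_of_mul_X {K : Type*} [CommRing K] {d : ℕ} (hd : 1 ≤ d) {α β : K}
    {P Q : MvPolynomial (Fin 2) K}
    (h : P * X 0 = C α * X 0 ^ (d + 1) + C β * X 0 ^ d * X 1 + X 1 ^ 2 * Q) :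
    coeffMon d 0 P = α ∧ coeffMon (d - 1) 1 P = β := by
  have hP (p q : ℕ) : coeffMon p q P =
      coeff (Finsupp.single 0 (p + 1) + Finsupp.single 1 q) (P * X 0) := by
    rw [coeffMon, ← coeff_mul_X _ 0, Finsupp.single_add, add_right_comm]
  have hα : (C α * X 0 ^ (d + 1) : MvPolynomial (Fin 2) K) =
      monomial (Finsupp.single 0 (d + 1)) α := by
    rw [X_pow_eq_monomial, C_mul_monomial, mul_one]
  have hβ : (C β * X 0 ^ d * X 1 : MvPolynomial (Fin 2) K) =
      monomial (Finsupp.single 0 d + Finsupp.single 1 1) β := by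
    rw [X_pow_eq_monomial, C_mul_monomial, X, monomial_mul, mul_one, mul_one]
  rw [hP, hP, h, hα, hβ, X_pow_eq_monomial]
  obtain ⟨e, rfl⟩ := Nat.exists_eq_add_of_le' hd
  constructor <;>
    simp [coeff_monomial_mul', coeff_monomial, Finsupp.ext_iff, Finsupp.le_def, Fin.forall_fin_two]

theorem coeffMon_fpow {K : Type*} [CommRing K] {d n : ℕ} (hd : 1 ≤ d) (i : Fin n)
    {v : Fin n → ℤ} (hv : v ∈ Delta n d) (a : Fin n → K) (f : Fin n → MvPolynomial (Fin 2) K)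
    (hfi : f i = MvPolynomial.X 1)
    (hfj : ∀ j, j ≠ i →
      f j = MvPolynomial.X 0 - MvPolynomial.C (a j) * MvPolynomial.X 1) :
    coeffMon d 0 (fpow f v) = (if v i = 0 then 1 else 0) ∧
      coeffMon (d - 1) 1 (fpow f v) =
        if v i = 0 then -∑ j ∈ Finset.univ.erase i, a j * (v j : K)
        else if v i = 1 then 1 else 0 := by
  obtain ⟨hnn, hsum⟩ := hv
  lift v to Fin n → ℕ using hnn
  obtain ⟨Q, hQ⟩ := exists_prod_X_sub_C_mul_X_pow_mul_X (Finset.univ.erase i) a v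
  have hd' : d = v i + ∑ j ∈ Finset.univ.erase i, v j := by
    rw [Finset.add_sum_erase _ _ (Finset.mem_univ i)]
    beta_reduce at hsum
    exact_mod_cast hsum.symm
  have hprod : fpow f (fun j => (v j : ℤ)) * MvPolynomial.X 0 = MvPolynomial.X 1 ^ v i *
      ((∏ j ∈ Finset.univ.erase i,
        (MvPolynomial.X 0 - MvPolynomial.C (a j) * MvPolynomial.X 1) ^ v j) *
          MvPolynomial.X 0) := by
    rw [fpow, ← Finset.mul_prod_erase _ _ (Finset.mem_univ i), hfi, mul_assoc]
    congr 2
    exact Finset.prod_congr rfl fun j hj => by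
      rw [hfj j (Finset.ne_of_mem_erase hj), Int.toNat_natCast]
  rw [hQ] at hprod
  simp only [Int.cast_natCast, Nat.cast_eq_zero, Nat.cast_eq_one]
  generalize ∑ j ∈ Finset.univ.erase i, v j = N at *
  generalize ∑ j ∈ Finset.univ.erase i, a j * (v j : K) = c at *
  rcases hvi : v i with - | - | k <;> rw [hvi] at hprod hd'
  · refine coeffMon_eq_of_mul_X hd (Q := Q) ?_
    obtain rfl : d = N := by omega
    rw [hprod]
    simp only [if_pos, map_neg, map_one]
    ring
  · refine coeffMon_eq_of_mul_X hd
      (Q := -MvPolynomial.C c * MvPolynomial.X 0 ^ N + MvPolynomial.X 1 * Q) ?_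
    obtain rfl : d = N + 1 := by omega
    rw [hprod]
    simp
    ring
  · refine coeffMon_eq_of_mul_X hd (Q := MvPolynomial.X 1 ^ k *
      (MvPolynomial.X 0 ^ (N + 1) - MvPolynomial.C c * MvPolynomial.X 0 ^ N * MvPolynomial.X 1
        + MvPolynomial.X 1 ^ 2 * Q)) ?_
    rw [hprod]
    simp
    ring

theorem statement_3 (K : Type*) [Field K] (d ℓ : ℕ) (hd : 1 ≤ d)
    (i : Fin (ℓ + 1))
    (B : Set (Fin (ℓ + 1) → ℤ))
    (hBΔ : B ⊆ Delta (ℓ + 1) d)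
    (hbpf : Basepointfree B)
    (a : Fin (ℓ + 1) → K)
    (hdist : ∀ j k, j ≠ i → k ≠ i → j ≠ k → a j ≠ a k)
    (hgen : ∀ v ∈ B, ∀ v' ∈ B, v ≠ v' → v i = 0 → v' i = 0 →
      ∑ j ∈ Finset.univ.erase i, a j * ((v j - v' j : ℤ) : K) ≠ 0)
    (f : Fin (ℓ + 1) → MvPolynomial (Fin 2) K)
    (hfi : f i = MvPolynomial.X 1)
    (hfj : ∀ j, j ≠ i →
      f j = MvPolynomial.X 0 - MvPolynomial.C (a j) * MvPolynomial.X 1) :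
    (∃ lam : K, ∀ v ∈ B,
        lam * coeffMon d 0 (fpow f v) + coeffMon (d - 1) 1 (fpow f v) = 0) ↔
      ((∀ v ∈ B, v i ≠ 1) ∧ (∃! v, v ∈ B ∧ v i = 0)) := by
  have hcoeff (v : Fin (ℓ + 1) → ℤ) (hv : v ∈ B) := coeffMon_fpow hd i (hBΔ hv) a f hfi hfj
  constructor
  · rintro ⟨lam, hlam⟩
    have hlam_eq (v : Fin (ℓ + 1) → ℤ) (hv : v ∈ B) (hvi : v i = 0) :
        ∑ j ∈ Finset.univ.erase i, a j * (v j : K) = lam := by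
      have h := hlam v hv
      rw [(hcoeff v hv).1, (hcoeff v hv).2, if_pos hvi, if_pos hvi] at h
      linear_combination -h
    refine ⟨fun v hv hvi => ?_, ?_⟩
    · have h := hlam v hv
      rw [(hcoeff v hv).1, (hcoeff v hv).2] at h
      simp [hvi] at h
    · obtain ⟨v, hv, hvi⟩ := hbpf i
      refine ⟨v, ⟨hv, hvi⟩, fun w ⟨hw, hwi⟩ => ?_⟩
      by_contra hne
      refine hgen w hw v hv hne hwi hvi ?_
      simp only [Int.cast_sub, mul_sub, Finset.sum_sub_distrib]
      rw [hlam_eq w hw hwi, hlam_eq v hv hvi, sub_self]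
  · rintro ⟨hone, v, -, huniq⟩
    refine ⟨∑ j ∈ Finset.univ.erase i, a j * (v j : K), fun w hw => ?_⟩
    rw [(hcoeff w hw).1, (hcoeff w hw).2]
    by_cases hwi : w i = 0
    · obtain rfl := huniq w ⟨hw, hwi⟩
      simp [hwi]
    · simp [hwi, hone w hw]
end

section
/- Let K be a field, let d ≥ 1 and ℓ ≥ 1 be natural numbers, and fix distinct indices i, j ∈ {0,…,ℓ}. Let B ⊆ Δ_ℓ(d) be basepoint-free. Let (z_k)_{k≠i,j} be pairwise distinct elements of Kˣ such that for all distinct v, v′ ∈ B with v_i = v_j = v′_i = v′_j = 0 one has ∏_{k≠i,j} z_k^{v_k − v′_k} ≠ 1. Set f_i = y_1, f_j = y_0, and f_k = y_0 − z_k y_1 for k ≠ i,j. Then the following are equivalent: (a) there exists (λ,μ) ∈ K² \ {(0,0)} such that for every v ∈ B, λ·(coefficient of y_0^d in f^v) + μ·(coefficient of y_1^d in f^v) = 0; (b) there is exactly one v ∈ B with v_i = v_j = 0, and every other v′ ∈ B satisfies v′_i > 0 and v′_j > 0. (Geometrically: the center of the projection defining the rational curve C_{B,f} meets the secant line of the rational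 normal curve through the marked points P_i and P_j if and only if B has a marked node at the pair (i,j).) -/
open MvPolynomial in
/-- For a form of degree `d`, the coefficient of `X i ^ d` is the value at the `i`-th
coordinate vector. -/
theorem MvPolynomial.IsHomogeneous.eval_piSingle {σ R : Type*} [Fintype σ] [DecidableEq σ]
    [CommSemiring R] {P : MvPolynomial σ R} {d : ℕ} (hP : P.IsHomogeneous d) (i : σ) :
    eval (Pi.single i 1) P = coeff (Finsupp.single i d) P := by
  rw [eval_eq', Finset.sum_eq_single (Finsupp.single i d)]
  · have h : ∏ k, (Pi.single i 1 : σ → R) k ^ (Finsupp.single i d) k = 1 := by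
      refine Finset.prod_eq_one fun k _ => ?_
      by_cases hk : k = i
      · subst hk; simp
      · simp [Finsupp.single_eq_of_ne hk]
    rw [h, mul_one]
  · intro m hm hmi
    obtain ⟨k, hki, hk⟩ : ∃ k, k ≠ i ∧ m k ≠ 0 := by
      by_contra! h
      have hm' : m = Finsupp.single i (m i) := by
        ext k
        by_cases hk : k = i
        · subst hk; simp
        · rw [Finsupp.single_eq_of_ne hk, h k hk]
      have hdeg := hP (mem_support_iff.mp hm)
      rw [hm', Finsupp.weight_single] at hdeg
      simp only [Pi.one_apply, smul_eq_mul, mul_one] at hdeg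
      exact hmi (hdeg ▸ hm')
    rw [Finset.prod_eq_zero (Finset.mem_univ k), mul_zero]
    rw [Pi.single_eq_of_ne hki, zero_pow hk]
  · intro h
    rw [notMem_support_iff.mp h, zero_mul]

/-- A product of linear forms with exponent vector in `Delta n d` is a form of degree `d`. -/
theorem isHomogeneous_fpow {K : Type*} [CommRing K] {n d : ℕ}
    {f : Fin n → MvPolynomial (Fin 2) K} (hf : ∀ k, (f k).IsHomogeneous 1)
    {v : Fin n → ℤ} (hv : v ∈ Delta n d) : (fpow f v).IsHomogeneous d := by
  have hsum : ∑ k, 1 * (v k).toNat = d := by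
    have h : ∑ k, ((v k).toNat : ℤ) = d := by
      rw [← hv.2]
      exact Finset.sum_congr rfl fun k _ => Int.toNat_of_nonneg (hv.1 k)
    simp only [one_mul]
    exact_mod_cast h
  rw [← hsum]
  exact MvPolynomial.IsHomogeneous.prod _ _ _ fun k _ => (hf k).pow _

theorem eval_fpow {K : Type*} [CommRing K] {n : ℕ} (f : Fin n → MvPolynomial (Fin 2) K)
    (v : Fin n → ℤ) (x : Fin 2 → K) {i j : Fin n} (hij : i ≠ j) :
    MvPolynomial.eval x (fpow f v) =
      MvPolynomial.eval x (f i) ^ (v i).toNat * (MvPolynomial.eval x (f j) ^ (v j).toNat *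
        ∏ k ∈ (Finset.univ.erase i).erase j, MvPolynomial.eval x (f k) ^ (v k).toNat) := by
  rw [fpow, map_prod]
  simp only [map_pow]
  rw [Finset.mul_prod_erase _ (fun k => MvPolynomial.eval x (f k) ^ (v k).toNat)
      (Finset.mem_erase.mpr ⟨hij.symm, Finset.mem_univ j⟩),
    Finset.mul_prod_erase _ (fun k => MvPolynomial.eval x (f k) ^ (v k).toNat)
      (Finset.mem_univ i)]

/-- Signs cancel in a quotient of two monomials of the same degree. -/
theorem prod_zpow_sub_eq_one_of_prod_neg_pow_eq {K ι : Type*} [Field K] {s : Finset ι}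
    {z : ι → K} (hz : ∀ k ∈ s, z k ≠ 0) {v w : ι → ℤ} (hv : ∀ k ∈ s, 0 ≤ v k)
    (hw : ∀ k ∈ s, 0 ≤ w k) (hsum : ∑ k ∈ s, v k = ∑ k ∈ s, w k)
    (h : ∏ k ∈ s, (-z k) ^ (v k).toNat = ∏ k ∈ s, (-z k) ^ (w k).toNat) :
    ∏ k ∈ s, z k ^ (v k - w k) = 1 := by
  have toZpow : ∀ u : ι → ℤ, (∀ k ∈ s, 0 ≤ u k) →
      ∏ k ∈ s, (-z k) ^ (u k).toNat = (-1) ^ (∑ k ∈ s, u k) * ∏ k ∈ s, z k ^ u k := by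
    intro u hu
    have hsign : ((-1 : K)) ^ (∑ k ∈ s, u k) = ∏ k ∈ s, (-1 : K) ^ u k := by
      classical
      refine Finset.induction_on s (by simp) fun a t ha ih => ?_
      rw [Finset.sum_insert ha, Finset.prod_insert ha,
        zpow_add₀ (neg_ne_zero.mpr one_ne_zero), ih]
    rw [hsign, ← Finset.prod_mul_distrib]
    refine Finset.prod_congr rfl fun k hk => ?_
    rw [← mul_zpow, neg_one_mul, ← zpow_natCast, Int.toNat_of_nonneg (hu k hk)]
  rw [toZpow v hv, toZpow w hw, hsum] at h
  have h' := mul_left_cancel₀ (zpow_ne_zero _ (neg_ne_zero.mpr one_ne_zero)) h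
  have hne : ∏ k ∈ s, z k ^ w k ≠ 0 := Finset.prod_ne_zero_iff.mpr fun k hk =>
    zpow_ne_zero _ (hz k hk)
  rw [Finset.prod_congr rfl fun k hk => zpow_sub₀ (hz k hk) (v k) (w k),
    Finset.prod_div_distrib, h', div_self hne]

theorem statement_4 (K : Type*) [Field K] (d ℓ : ℕ) (hd : 1 ≤ d) (hl : 1 ≤ ℓ)
    (i j : Fin (ℓ + 1)) (hij : i ≠ j)
    (B : Set (Fin (ℓ + 1) → ℤ))
    (hBΔ : B ⊆ Delta (ℓ + 1) d)
    (hbpf : Basepointfree B)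
    (z : Fin (ℓ + 1) → K)
    (hz0 : ∀ k, k ≠ i → k ≠ j → z k ≠ 0)
    (hdist : ∀ k l, k ≠ i → k ≠ j → l ≠ i → l ≠ j → k ≠ l → z k ≠ z l)
    (hgen : ∀ v ∈ B, ∀ v' ∈ B, v ≠ v' →
      v i = 0 → v j = 0 → v' i = 0 → v' j = 0 →
      ∏ k ∈ (Finset.univ.erase i).erase j, z k ^ (v k - v' k) ≠ 1)
    (f : Fin (ℓ + 1) → MvPolynomial (Fin 2) K)
    (hfi : f i = MvPolynomial.X 1)
    (hfj : f j = MvPolynomial.X 0)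
    (hfk : ∀ k, k ≠ i → k ≠ j →
      f k = MvPolynomial.X 0 - MvPolynomial.C (z k) * MvPolynomial.X 1) :
    (∃ lam mu : K, (lam, mu) ≠ (0, 0) ∧ ∀ v ∈ B,
        lam * coeffMon d 0 (fpow f v) + mu * coeffMon 0 d (fpow f v) = 0) ↔
      (∃ v ∈ B, v i = 0 ∧ v j = 0 ∧
        ∀ v' ∈ B, v' ≠ v → 0 < v' i ∧ 0 < v' j) := by
  have hf : ∀ k, (f k).IsHomogeneous 1 := by
    intro k
    by_cases hki : k = i
    · rw [hki, hfi]; exact MvPolynomial.isHomogeneous_X _ _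
    by_cases hkj : k = j
    · rw [hkj, hfj]; exact MvPolynomial.isHomogeneous_X _ _
    rw [hfk k hki hkj]
    refine (MvPolynomial.isHomogeneous_X _ _).sub ?_
    simpa using (MvPolynomial.isHomogeneous_C (Fin 2) (z k)).mul
      (MvPolynomial.isHomogeneous_X K (1 : Fin 2))
  set s := (Finset.univ.erase i).erase j with hs
  have hmem : ∀ k ∈ s, k ≠ i ∧ k ≠ j := fun k hk => by
    simp only [hs, Finset.mem_erase] at hk
    exact ⟨hk.2.1, hk.1⟩
  set c : (Fin (ℓ + 1) → ℤ) → K := fun v => ∏ k ∈ s, (-z k) ^ (v k).toNat with hc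
  have hc0 : ∀ v, c v ≠ 0 := fun v => Finset.prod_ne_zero_iff.mpr fun k hk =>
    pow_ne_zero _ (neg_ne_zero.mpr (hz0 k (hmem k hk).1 (hmem k hk).2))
  have hcoeff₀ : ∀ v ∈ B, coeffMon d 0 (fpow f v) = 0 ^ (v i).toNat := by
    intro v hv
    rw [coeffMon, Finsupp.single_zero, add_zero,
      ← (isHomogeneous_fpow hf (hBΔ hv)).eval_piSingle, eval_fpow f v _ hij,
      Finset.prod_eq_one fun k hk => ?_]
    · simp [hfi, hfj]
    · simp [hfk k (hmem k hk).1 (hmem k hk).2]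
  have hcoeff₁ : ∀ v ∈ B, coeffMon 0 d (fpow f v) = 0 ^ (v j).toNat * c v := by
    intro v hv
    rw [coeffMon, Finsupp.single_zero, zero_add,
      ← (isHomogeneous_fpow hf (hBΔ hv)).eval_piSingle, eval_fpow f v _ hij,
      Finset.prod_congr (g := fun k => (-z k) ^ (v k).toNat) rfl fun k hk => ?_]
    · simp [hfi, hfj, hc, hs]
    · simp [hfk k (hmem k hk).1 (hmem k hk).2]
  have hpos : ∀ v ∈ B, ∀ k, v k ≠ 0 → 0 < v k := fun v hv k hk =>
    lt_of_le_of_ne ((hBΔ hv).1 k) hk.symm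
  have hpow : ∀ v ∈ B, ∀ k, v k ≠ 0 → (0 : K) ^ (v k).toNat = 0 := fun v hv k hk =>
    zero_pow (by have := hpos v hv k hk; omega)
  have hsum : ∀ v ∈ B, v i = 0 → v j = 0 → ∑ k ∈ s, v k = d := by
    intro v hv hvi hvj
    rw [hs, Finset.sum_erase _ hvj, Finset.sum_erase _ hvi, (hBΔ hv).2]
  constructor
  · rintro ⟨lam, mu, hne, hrel⟩
    replace hrel : ∀ v ∈ B, lam * 0 ^ (v i).toNat + mu * (0 ^ (v j).toNat * c v) = 0 := by
      intro v hv
      rw [← hcoeff₀ v hv, ← hcoeff₁ v hv, hrel v hv]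
    obtain ⟨v, hv, hvi⟩ := hbpf i
    obtain ⟨w, hw, hwj⟩ := hbpf j
    have hmu : mu ≠ 0 := by
      rintro rfl
      have := hrel v hv
      simp only [hvi, Int.toNat_zero, pow_zero, mul_one, zero_mul, add_zero] at this
      exact hne (by rw [this])
    have hlam : lam ≠ 0 := by
      rintro rfl
      have := hrel w hw
      simp [hwj, hmu, hc0 w] at this
    have hiff : ∀ u ∈ B, (u i = 0 ↔ u j = 0) := by
      intro u hu
      have h := hrel u hu
      constructor
      · intro hui
        by_contra huj
        rw [hpow u hu j huj, hui] at h
        simp [hlam] at h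
      · intro huj
        by_contra hui
        rw [hpow u hu i hui, huj] at h
        simp [hmu, hc0 u] at h
    have hvj := (hiff v hv).mp hvi
    refine ⟨v, hv, hvi, hvj, fun u hu huv => ?_⟩
    have hui : u i ≠ 0 := by
      intro hui
      have huj := (hiff u hu).mp hui
      refine hgen u hu v hv huv hui huj hvi hvj ?_
      refine prod_zpow_sub_eq_one_of_prod_neg_pow_eq
        (fun k hk => hz0 k (hmem k hk).1 (hmem k hk).2) (fun k _ => (hBΔ hu).1 k)
        (fun k _ => (hBΔ hv).1 k) ((hsum u hu hui huj).trans (hsum v hv hvi hvj).symm) ?_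
      have h₁ := hrel u hu
      have h₂ := hrel v hv
      simp only [hui, huj, hvi, hvj, Int.toNat_zero, pow_zero, mul_one, one_mul] at h₁ h₂
      exact mul_left_cancel₀ hmu (add_left_cancel (h₁.trans h₂.symm))
    exact ⟨hpos u hu i hui, hpos u hu j fun huj => hui ((hiff u hu).mpr huj)⟩
  · rintro ⟨v, hv, hvi, hvj, hother⟩
    refine ⟨c v, -1, by simp, fun u hu => ?_⟩
    rw [hcoeff₀ u hu, hcoeff₁ u hu]
    by_cases huv : u = v
    · rw [huv, hvi, hvj]
      simp
    · obtain ⟨hui, huj⟩ := hother u hu huv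
      rw [hpow u hu i hui.ne', hpow u hu j huj.ne']
      simp
end

section
/- Let K be an algebraically closed field of characteristic zero and let ℓ ≥ 2. Let Λ ⊆ ℤ^{ℓ+1} be a subgroup of rank 2 contained in the hyperplane {v ∈ ℤ^{ℓ+1} : v_0 + ⋯ + v_ℓ = 0}, and assume Λ satisfies the secant condition over K. Let α ≠ β be indices such that the projection of Λ to the (α,β)-coordinates has rank 2, i.e., there exist v, w ∈ Λ with v_α w_β − v_β w_α ≠ 0. Then there exist indices γ ≠ δ with (α,β) ≠ (δ,γ) such that e_α − e_β + e_γ − e_δ ∈ Λ, where e_0,…,e_ℓ is the standard basis of ℤ^{ℓ+1}. -/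
/-- `Λ` satisfies the secant condition over `K` if for every point `z` of the
quasitorus `Y(Λ) = {z ∈ (Kˣ)^n : z^v = 1 ∀ v ∈ Λ}` there is
`(a,b) ≠ (0,0)` such that the vector `(a zᵢ + b zᵢ⁻¹)ᵢ` lies in `Λ^⊥_K`. -/
def SecantCondition (K : Type*) [Field K] {n : ℕ} (Λ : AddSubgroup (Fin n → ℤ)) : Prop :=
  ∀ z : Fin n → K, (∀ i, z i ≠ 0) → (∀ v ∈ Λ, ∏ i, z i ^ (v i) = 1) →
    ∃ a b : K, (a, b) ≠ (0, 0) ∧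
      ∀ v ∈ Λ, ∑ i, (a * z i + b * (z i)⁻¹) * ((v i : ℤ) : K) = 0

/-- A sum of values at `f p` with coefficients `c p` over a linearly independent family: if it
vanishes, a nonzero coefficient at `p` forces a second index `q` with the same label `f q = f p` and
a nonzero coefficient. -/
theorem LinearIndependent.exists_ne_of_sum_smul_eq_zero {R M ι κ : Type*} [Ring R] [AddCommGroup M]
    [Module R M] [Fintype κ] {u : ι → M} (hu : LinearIndependent R u) (f : κ → ι) (c : κ → R)
    (h : ∑ p, c p • u (f p) = 0) {p : κ} (hp : c p ≠ 0) :
    ∃ q, q ≠ p ∧ f q = f p ∧ c q ≠ 0 := by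
  classical
  by_contra! H
  have h0 : ∑ q, Finsupp.single (f q) (c q) = 0 := by
    rw [linearIndependent_iff] at hu
    apply hu
    simpa [map_sum] using h
  apply hp
  have h1 := DFunLike.congr_fun h0 (f p)
  rw [Finsupp.finsetSum_apply, Finset.sum_eq_single p] at h1
  · simpa using h1
  · intro q _ hqp
    by_cases hq : f q = f p
    · simp [H q hqp hq]
    · simp [hq]
  · simp

/-- Characters with values in the unit group of an algebraically closed field of characteristic
zero separate the points of an abelian group. -/
theorem AddMonoidHom.exists_units_apply_ne_zero (K : Type*) [Field K] [IsAlgClosed K] [CharZero K]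
    {A : Type*} [AddCommGroup A] {g : A} (hg : g ≠ 0) :
    ∃ χ : A →+ Additive Kˣ, χ g ≠ 0 := by
  have hroot : ∀ (n : ℤ), n ≠ 0 → ∀ x : Additive Kˣ, ∃ y, n • y = x := by
    intro n hn x
    obtain ⟨y, hy⟩ := IsAlgClosed.exists_pow_nat_eq (x.toMul : K) (Int.natAbs_pos.mpr hn)
    have hy0 : y ≠ 0 := by
      rintro rfl
      rw [zero_pow (Int.natAbs_ne_zero.mpr hn)] at hy
      exact x.toMul.ne_zero hy.symm
    have key : n.natAbs • Additive.ofMul (Units.mk0 y hy0) = x := by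
      apply Additive.toMul.injective
      ext
      simpa using hy
    rcases Int.natAbs_eq n with h | h
    · exact ⟨Additive.ofMul (Units.mk0 y hy0), by rw [h, natCast_zsmul, key]⟩
    · exact ⟨-Additive.ofMul (Units.mk0 y hy0), by rw [h, neg_smul_neg, natCast_zsmul, key]⟩
  let _ : DivisibleBy (Additive Kˣ) ℤ :=
    divisibleByOfSMulRightSurj _ _ fun {n} hn => hroot n hn
  have hζ : ∃ ζ : Additive Kˣ, addOrderOf g • ζ = 0 ∧ ζ ≠ 0 := by
    rcases eq_or_ne (addOrderOf g) 0 with h0 | h0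
    · refine ⟨Additive.ofMul (Units.mk0 2 two_ne_zero), by simp [h0], ?_⟩
      intro h
      have := congrArg (fun x : Additive Kˣ => (x.toMul : K)) h
      norm_num at this
    · have : NeZero (addOrderOf g) := ⟨h0⟩
      obtain ⟨ζ, hζ⟩ := HasEnoughRootsOfUnity.exists_primitiveRoot K (addOrderOf g)
      refine ⟨Additive.ofMul (hζ.isUnit h0).unit, ?_, ?_⟩
      · apply Additive.toMul.injective
        ext
        simpa using hζ.pow_eq_one
      · intro h
        have h1 := congrArg (fun x : Additive Kˣ => (x.toMul : K)) h
        have h2 : ζ = 1 := by simpa using h1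
        subst h2
        exact hg (AddMonoid.addOrderOf_eq_one_iff.mp (by simpa using hζ.eq_orderOf))
  obtain ⟨ζ, hζ, hζ0⟩ := hζ
  let φ : (ℤ ∙ g) →ₗ[ℤ] Additive Kˣ :=
    Submodule.liftQSpanSingleton _ (LinearMap.toSpanSingleton ℤ _ ζ) (by simpa using hζ) ∘ₗ
      (CharacterModule.intSpanEquivQuotAddOrderOf g).toLinearMap
  obtain ⟨χ, hχ⟩ := (Module.Baer.of_divisible (Additive Kˣ)).extension_property
    (Submodule.subtype (ℤ ∙ g)) (Submodule.subtype_injective _) φ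
  refine ⟨χ.toAddMonoidHom, ?_⟩
  have h := DFunLike.congr_fun hχ ⟨g, Submodule.mem_span_singleton_self g⟩
  have h' : χ g = ζ := by
    rw [LinearMap.comp_apply] at h
    refine h.trans ?_
    simp only [φ, LinearMap.comp_apply, LinearEquiv.coe_coe]
    rw [CharacterModule.intSpanEquivQuotAddOrderOf_apply_self]
    rw [Submodule.liftQSpanSingleton_apply, LinearMap.toSpanSingleton_apply_one]
  simpa [h'] using hζ0

/-- Evaluations at the points of an abelian group are linearly independent functions on its group of
characters. -/
theorem linearIndependent_character_eval (K : Type*) [Field K] [IsAlgClosed K] [CharZero K]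
    (A : Type*) [AddCommGroup A] :
    LinearIndependent K fun (g : A) (χ : Multiplicative A →* Kˣ) =>
      (χ (Multiplicative.ofAdd g) : K) := by
  refine (linearIndependent_monoidHom (Multiplicative A →* Kˣ) K).comp
    (fun g : A => (Units.coeHom K).comp (MonoidHom.eval (Multiplicative.ofAdd g))) ?_
  intro g h hgh
  by_contra hne
  obtain ⟨χ, hχ⟩ := AddMonoidHom.exists_units_apply_ne_zero K (sub_ne_zero.mpr hne)
  have h1 := DFunLike.congr_fun hgh (AddMonoidHom.toMultiplicativeLeft χ)
  have h2 : χ g = χ h := Additive.toMul.injective (Units.ext h1)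
  exact hχ (by rw [map_sub, h2, sub_self])

/-- Under the secant condition the two vectors `∑ zᵢ uᵢ` and `∑ zᵢ⁻¹ uᵢ`, for `uᵢ = (vᵢ, wᵢ)`, are
linearly dependent, so their determinant vanishes. -/
theorem SecantCondition.sum_det_eq_zero {K : Type*} [Field K] {n : ℕ}
    {Λ : AddSubgroup (Fin n → ℤ)} (hsec : SecantCondition K Λ) {v w : Fin n → ℤ} (hv : v ∈ Λ)
    (hw : w ∈ Λ) {z : Fin n → K} (hz : ∀ i, z i ≠ 0) (hzΛ : ∀ v ∈ Λ, ∏ i, z i ^ (v i) = 1) :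
    ∑ p : Fin n × Fin n, ((v p.1 * w p.2 - v p.2 * w p.1 : ℤ) : K) * (z p.1 * (z p.2)⁻¹) = 0 := by
  obtain ⟨a, b, hab, h⟩ := hsec z hz hzΛ
  have expand : ∀ u : Fin n → ℤ, ∑ i, (a * z i + b * (z i)⁻¹) * (u i : K) =
      a * ∑ i, z i * (u i : K) + b * ∑ i, (z i)⁻¹ * (u i : K) := fun u => by
    rw [Finset.mul_sum, Finset.mul_sum, ← Finset.sum_add_distrib]
    exact Finset.sum_congr rfl fun i _ => by ring
  have h1 := h v hv
  have h2 := h w hw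
  rw [expand] at h1 h2
  have hdet : ∑ p : Fin n × Fin n,
      ((v p.1 * w p.2 - v p.2 * w p.1 : ℤ) : K) * (z p.1 * (z p.2)⁻¹) =
      (∑ i, z i * (v i : K)) * (∑ i, (z i)⁻¹ * (w i : K)) -
        (∑ i, z i * (w i : K)) * (∑ i, (z i)⁻¹ * (v i : K)) := by
    rw [Finset.sum_mul_sum, Finset.sum_mul_sum, ← Finset.sum_sub_distrib, Fintype.sum_prod_type]
    refine Finset.sum_congr rfl fun i _ => ?_
    rw [← Finset.sum_sub_distrib]
    refine Finset.sum_congr rfl fun j _ => ?_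
    push_cast
    ring
  rw [hdet]
  by_cases ha : a = 0
  · have hb : b ≠ 0 := by
      rintro rfl
      exact hab (by rw [ha])
    refine (mul_eq_zero.mp ?_).resolve_left hb
    linear_combination (∑ i, z i * (v i : K)) * h2 - (∑ i, z i * (w i : K)) * h1
  · refine (mul_eq_zero.mp ?_).resolve_left ha
    linear_combination (∑ i, (z i)⁻¹ * (w i : K)) * h1 - (∑ i, (z i)⁻¹ * (v i : K)) * h2

/-- A character of `ℤⁿ / Λ` is a point of the quasitorus of `Λ`. -/
theorem prod_character_single_zpow {M : Type*} [CommGroup M] {n : ℕ} {Λ : AddSubgroup (Fin n → ℤ)}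
    (χ : Multiplicative ((Fin n → ℤ) ⧸ Λ) →* M) {v : Fin n → ℤ} (hv : v ∈ Λ) :
    ∏ i, χ (Multiplicative.ofAdd (QuotientAddGroup.mk' Λ (Pi.single i 1))) ^ v i = 1 := by
  have h : ∑ i, v i • QuotientAddGroup.mk' Λ (Pi.single i 1) = 0 := by
    rw [← (QuotientAddGroup.eq_zero_iff v).mpr hv]
    conv_rhs => rw [← Finset.univ_sum_single v]
    rw [← QuotientAddGroup.mk'_apply, map_sum]
    refine Finset.sum_congr rfl fun i _ => ?_
    rw [← map_zsmul, ← Pi.single_smul, smul_eq_mul, mul_one]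
  simp_rw [← map_zpow, ← ofAdd_zsmul]
  rw [← map_prod, ← ofAdd_sum, h, ofAdd_zero, map_one]

theorem statement_8 (K : Type*) [Field K] [IsAlgClosed K] [CharZero K]
    (ℓ : ℕ) (hl : 2 ≤ ℓ)
    (Λ : AddSubgroup (Fin (ℓ + 1) → ℤ))
    (hrank : Module.finrank ℤ (AddSubgroup.toIntSubmodule Λ) = 2)
    (hsum : ∀ v ∈ Λ, ∑ i, v i = 0)
    (hsec : SecantCondition K Λ)
    (α β : Fin (ℓ + 1)) (hαβ : α ≠ β)
    (hproj : ∃ v ∈ Λ, ∃ w ∈ Λ, v α * w β - v β * w α ≠ 0) :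
    ∃ γ δ : Fin (ℓ + 1), γ ≠ δ ∧ (α, β) ≠ (δ, γ) ∧
      (Pi.single α 1 - Pi.single β 1 + Pi.single γ 1 - Pi.single δ 1 :
        Fin (ℓ + 1) → ℤ) ∈ Λ := by
  obtain ⟨v, hv, w, hw, hvw⟩ := hproj
  let π := QuotientAddGroup.mk' Λ
  obtain ⟨⟨δ, γ⟩, hne, hlabel, hcoeff⟩ :=
    (linearIndependent_character_eval K _).exists_ne_of_sum_smul_eq_zero
      (fun p : Fin (ℓ + 1) × Fin (ℓ + 1) => π (Pi.single p.1 1) - π (Pi.single p.2 1))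
      (fun p => ((v p.1 * w p.2 - v p.2 * w p.1 : ℤ) : K))
      (by
        ext χ
        have h := hsec.sum_det_eq_zero hv hw
          (z := fun i => (χ (Multiplicative.ofAdd (π (Pi.single i 1))) : K))
          (fun i => Units.ne_zero _)
          (fun u hu => by
            have := congrArg (Units.val) (prod_character_single_zpow χ hu)
            simpa [π] using this)
        rw [Finset.sum_apply]
        simpa [ofAdd_sub, map_div, div_eq_mul_inv] using h)
      (p := (α, β)) (by exact_mod_cast hvw)
  refine ⟨γ, δ, ?_, hne.symm, ?_⟩
  · rintro rfl
    simp at hcoeff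
  · rw [← QuotientAddGroup.eq_zero_iff, ← QuotientAddGroup.mk'_apply, map_sub, map_add, map_sub]
    change π _ - π _ + π _ - π _ = 0
    rw [← hlabel]
    abel
end

section
/- Let K be an algebraically closed field of characteristic zero, let d ≥ 1 and ℓ ≥ 2, and let B ⊆ Δ_ℓ(d) be basepoint-free and concise such that Λ := ⟨B⟩ has rank 2 and e_i − e_j ∉ Λ for all i ≠ j. Assume Λ satisfies the secant condition over K. Then Λ is generated by two elements x and y, each of the form e_α − e_β + e_γ − e_δ for some indices with α ≠ β, γ ≠ δ and (α,β) ≠ (δ,γ), whose supports intersect in at least one coordinate (there is an index at which both x and y are nonzero). -/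
/-- `x` is of the form `e_α − e_β + e_γ − e_δ` with `α ≠ β`, `γ ≠ δ`,
`(α,β) ≠ (δ,γ)`. -/
def FourTerm {n : ℕ} (x : Fin n → ℤ) : Prop :=
  ∃ α β γ δ : Fin n, α ≠ β ∧ γ ≠ δ ∧ (α, β) ≠ (δ, γ) ∧
    x = Pi.single α 1 - Pi.single β 1 + Pi.single γ 1 - Pi.single δ 1

section SecantLattice

variable {n : ℕ}

/-- Over an algebraically closed field of characteristic zero, the quasitorus `Y(Λ)` separates
the lattice vectors outside `Λ` from `0`. -/
lemma exists_quasitorus_point_prod_zpow_ne_one (K : Type*) [Field K] [IsAlgClosed K] [CharZero K]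
    (Λ : AddSubgroup (Fin n → ℤ)) {w : Fin n → ℤ} (hw : w ∉ Λ) :
    ∃ z : Fin n → Kˣ, (∀ v ∈ Λ, ∏ i, z i ^ v i = 1) ∧ ∏ i, z i ^ w i ≠ 1 := by
  have hw' : (QuotientAddGroup.mk w : (Fin n → ℤ) ⧸ Λ) ≠ 0 := by
    rwa [Ne, QuotientAddGroup.eq_zero_iff]
  obtain ⟨c, hc⟩ := CharacterModule.exists_character_apply_ne_zero_of_ne_zero hw'
  choose q hq using fun i : Fin n ↦
    QuotientAddGroup.mk_surjective (c (QuotientAddGroup.mk (Pi.single i (1 : ℤ))))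
  obtain ⟨N, hN, a, ha⟩ : ∃ N : ℕ, N ≠ 0 ∧ ∃ a : Fin n → ℤ, ∀ i, q i = a i / N := by
    refine ⟨∏ i, (q i).den, Finset.prod_ne_zero_iff.2 fun i _ ↦ (q i).den_ne_zero,
      fun i ↦ (q i).num * ∏ j ∈ Finset.univ.erase i, ((q j).den : ℤ), fun i ↦ ?_⟩
    have h : ∀ j, ((q j).den : ℚ) ≠ 0 := fun j ↦ by exact_mod_cast (q j).den_ne_zero
    rw [← Finset.mul_prod_erase Finset.univ (fun j ↦ (q j).den) (Finset.mem_univ i)]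
    push_cast
    rw [mul_div_mul_right _ _ (Finset.prod_ne_zero_iff.2 fun j _ ↦ h j), Rat.num_div_den]
  have hcv (v : Fin n → ℤ) :
      c (QuotientAddGroup.mk v) = ((((∑ i, a i * v i : ℤ) : ℚ) / N : ℚ) : AddCircle (1 : ℚ)) := by
    have hv : v = ∑ i, v i • Pi.single i (1 : ℤ) := by
      conv_lhs => rw [← Finset.univ_sum_single v]
      exact Finset.sum_congr rfl fun i _ ↦ by rw [← Pi.single_smul, smul_eq_mul, mul_one]
    have h1 : (QuotientAddGroup.mk v : (Fin n → ℤ) ⧸ Λ) =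
        ∑ i, v i • QuotientAddGroup.mk (Pi.single i (1 : ℤ)) := by
      conv_lhs => rw [hv]
      exact map_sum (QuotientAddGroup.mk' Λ) _ _
    rw [h1, map_sum]
    simp only [map_zsmul, ← hq]
    rw [show (((∑ i, a i * v i : ℤ) : ℚ) / N : ℚ) = ∑ i, v i • q i by
      simp only [ha, zsmul_eq_mul]; push_cast; rw [Finset.sum_div]
      exact Finset.sum_congr rfl fun i _ ↦ by ring]
    exact (map_sum (QuotientAddGroup.mk' (AddSubgroup.zmultiples (1 : ℚ))) _ _).symm
  have : NeZero N := ⟨hN⟩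
  have hNK : NeZero (N : K) := ⟨by exact_mod_cast hN⟩
  obtain ⟨ζ, hζ⟩ := HasEnoughRootsOfUnity.exists_primitiveRoot K N
  obtain ⟨ζ, rfl⟩ := hζ.isUnit hN
  rw [IsPrimitiveRoot.coe_units_iff] at hζ
  have hz (v : Fin n → ℤ) : ∏ i, (ζ ^ a i) ^ v i = 1 ↔ c (QuotientAddGroup.mk v) = 0 := by
    simp only [← zpow_mul]
    rw [show ∏ i, ζ ^ (a i * v i) = ζ ^ ∑ i, a i * v i from
      (map_sum (zmultiplesHom (Additive Kˣ) (Additive.ofMul ζ)) (fun i ↦ a i * v i) _).symm,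
      hζ.zpow_eq_one_iff_dvd, hcv, AddCircle.coe_eq_zero_iff]
    have hNQ : (N : ℚ) ≠ 0 := by exact_mod_cast hN
    refine exists_congr fun k ↦ ?_
    rw [zsmul_one, eq_div_iff hNQ, eq_comm, mul_comm]
    norm_cast
  refine ⟨fun i ↦ ζ ^ a i, fun v hv ↦ (hz v).2 ?_, fun h ↦ hc ((hz w).1 h)⟩
  rw [(QuotientAddGroup.eq_zero_iff v).2 hv, map_zero]

/-- The subgroup of points of the quasitorus `Y(Λ)`, with unit coordinates. -/
def quasitorus (K : Type*) [Field K] (Λ : AddSubgroup (Fin n → ℤ)) : Subgroup (Fin n → Kˣ) where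
  carrier := {z | ∀ v ∈ Λ, ∏ i, z i ^ v i = 1}
  one_mem' := by simp
  mul_mem' {z z'} hz hz' v hv := by simp [mul_zpow, Finset.prod_mul_distrib, hz v hv, hz' v hv]
  inv_mem' {z} hz v hv := by simp [hz v hv]

/-- The character `z ↦ z_k / z_l` of the quasitorus. -/
def ratioChar (K : Type*) [Field K] (Λ : AddSubgroup (Fin n → ℤ)) (p : Fin n × Fin n) :
    quasitorus K Λ →* K where
  toFun z := ((z.1 p.1 * (z.1 p.2)⁻¹ : Kˣ) : K)
  map_one' := by simp
  map_mul' z z' := by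
    simp only [Subgroup.coe_mul, Pi.mul_apply, mul_inv, Units.val_mul]
    ring

lemma SecantCondition.sum_minor_smul_ratioChar {K : Type*} [Field K]
    {Λ : AddSubgroup (Fin n → ℤ)} (h : SecantCondition K Λ) {u v : Fin n → ℤ}
    (hu : u ∈ Λ) (hv : v ∈ Λ) :
    ∑ p : Fin n × Fin n, ((u p.1 * v p.2 - u p.2 * v p.1 : ℤ) : K) •
      (ratioChar K Λ p : quasitorus K Λ → K) = 0 := by
  ext z
  obtain ⟨a, b, hab, H⟩ := h (fun i ↦ (z.1 i : K)) (fun i ↦ (z.1 i).ne_zero)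
    fun v hv ↦ by simpa using congrArg (Units.val (α := K)) (z.2 v hv)
  have expand (v : Fin n → ℤ) : ∑ i, (a * (z.1 i : K) + b * (z.1 i : K)⁻¹) * (v i : K) =
      a * ∑ i, (z.1 i : K) * v i + b * ∑ i, (z.1 i : K)⁻¹ * v i := by
    simp only [Finset.mul_sum, ← Finset.sum_add_distrib]
    exact Finset.sum_congr rfl fun i _ ↦ by ring
  have hu' := H u hu
  have hv' := H v hv
  rw [expand] at hu' hv'
  have key : (∑ i, (z.1 i : K) * u i) * (∑ i, (z.1 i : K)⁻¹ * v i) -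
      (∑ i, (z.1 i : K) * v i) * (∑ i, (z.1 i : K)⁻¹ * u i) = 0 := by
    by_contra hne
    apply hab
    rw [Prod.mk.injEq]
    constructor
    · refine (mul_eq_zero.1 ?_).resolve_right hne
      linear_combination (∑ i, (z.1 i : K)⁻¹ * v i) * hu' - (∑ i, (z.1 i : K)⁻¹ * u i) * hv'
    · refine (mul_eq_zero.1 ?_).resolve_right hne
      linear_combination (∑ i, (z.1 i : K) * u i) * hv' - (∑ i, (z.1 i : K) * v i) * hu'
  rw [Finset.sum_mul_sum, Finset.sum_mul_sum, ← Finset.sum_sub_distrib] at key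
  rw [← Finset.univ_product_univ, Finset.sum_product, Finset.sum_apply, Pi.zero_apply, ← key]
  refine Finset.sum_congr rfl fun i _ ↦ ?_
  rw [← Finset.sum_sub_distrib, Finset.sum_apply]
  refine Finset.sum_congr rfl fun j _ ↦ ?_
  simp only [Pi.smul_apply, ratioChar, MonoidHom.coe_mk, OneHom.coe_mk, smul_eq_mul,
    Units.val_mul, Units.val_inv_eq_inv_val]
  push_cast
  ring

/-- By linear independence of characters, each nonzero `2 × 2` minor of the lattice is cancelled
by another one with the same character. -/
lemma SecantCondition.exists_single_sub_add_mem {K : Type*} [Field K] [IsAlgClosed K] [CharZero K]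
    {Λ : AddSubgroup (Fin n → ℤ)} (h : SecantCondition K Λ) {u v : Fin n → ℤ}
    (hu : u ∈ Λ) (hv : v ∈ Λ) {i j : Fin n} (hij : u i * v j ≠ u j * v i) :
    ∃ k l, (i, j) ≠ (k, l) ∧ k ≠ l ∧
      (Pi.single i 1 - Pi.single j 1 + Pi.single l 1 - Pi.single k 1 : Fin n → ℤ) ∈ Λ := by
  classical
  obtain ⟨⟨k, l⟩, hne, hkl, hchar⟩ : ∃ p : Fin n × Fin n, (i, j) ≠ p ∧
      u p.1 * v p.2 - u p.2 * v p.1 ≠ 0 ∧ ratioChar K Λ (i, j) = ratioChar K Λ p := by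
    by_contra! hcon
    have hsum := h.sum_minor_smul_ratioChar hu hv
    have hindep := linearIndependent_monoidHom (quasitorus K Λ) K
    let F : (quasitorus K Λ →* K) →₀ K := ∑ p : Fin n × Fin n,
      Finsupp.single (ratioChar K Λ p) ((u p.1 * v p.2 - u p.2 * v p.1 : ℤ) : K)
    have hF : F = 0 := by
      refine linearIndependent_iff.1 hindep F ?_
      simp only [F, map_sum, Finsupp.linearCombination_single]
      exact hsum
    have hFij := DFunLike.congr_fun hF (ratioChar K Λ (i, j))
    simp only [F, Finsupp.finsetSum_apply, Finsupp.zero_apply] at hFij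
    rw [Finset.sum_eq_single (i, j)] at hFij
    · rw [Finsupp.single_eq_same, Int.cast_eq_zero] at hFij
      exact hij (sub_eq_zero.1 hFij)
    · intro p _ hp
      by_cases hm : u p.1 * v p.2 - u p.2 * v p.1 = 0
      · simp [hm]
      · exact Finsupp.single_eq_of_ne (hcon p hp.symm hm)
    · simp
  refine ⟨k, l, hne, ?_, ?_⟩
  · rintro rfl
    simp at hkl
  · by_contra hmem
    obtain ⟨z, hz, hzw⟩ := exists_quasitorus_point_prod_zpow_ne_one K Λ hmem
    have hval := DFunLike.congr_fun hchar (⟨z, hz⟩ : quasitorus K Λ)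
    simp only [ratioChar, MonoidHom.coe_mk, OneHom.coe_mk, Units.val_inj] at hval
    have hs (m : Fin n) : ∏ i, z i ^ (Pi.single m (1 : ℤ) : Fin n → ℤ) i = z m := by
      rw [Finset.prod_eq_single m] <;> simp +contextual
    apply hzw
    simp only [Pi.sub_apply, Pi.add_apply, zpow_sub, zpow_add, Finset.prod_mul_distrib,
      Finset.prod_inv_distrib, hs]
    rw [hval]
    group

lemma SecantCondition.exists_fourTerm {K : Type*} [Field K] [IsAlgClosed K] [CharZero K]
    {Λ : AddSubgroup (Fin n → ℤ)} (h : SecantCondition K Λ)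
    (hne : ∀ i j : Fin n, i ≠ j → (Pi.single i 1 - Pi.single j 1 : Fin n → ℤ) ∉ Λ)
    {u v : Fin n → ℤ} (hu : u ∈ Λ) (hv : v ∈ Λ) {i j : Fin n} (hij : u i * v j ≠ u j * v i) :
    ∃ t ∈ Λ, FourTerm t ∧ 0 < t i ∧ t j < 0 := by
  obtain ⟨k, l, hneq, hkl, hmem⟩ := h.exists_single_sub_add_mem hu hv hij
  have hij' : i ≠ j := by rintro rfl; exact hij rfl
  have hki : k ≠ i := by
    rintro rfl
    refine hne l j (fun hlj ↦ hneq (by rw [hlj])) ?_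
    convert hmem using 1
    abel
  have hlj : l ≠ j := by
    rintro rfl
    refine hne i k (fun hik ↦ hneq (by rw [hik])) ?_
    convert hmem using 1
    abel
  refine ⟨_, hmem, ⟨i, j, l, k, hij', hkl.symm, hneq, rfl⟩, ?_, ?_⟩
  · simp only [Pi.sub_apply, Pi.add_apply, Pi.single_apply, if_neg hij', if_neg hki.symm]
    split_ifs <;> simp
  · simp only [Pi.sub_apply, Pi.add_apply, Pi.single_apply, if_neg hij'.symm, if_neg hlj.symm]
    split_ifs <;> simp

lemma FourTerm.sum_abs_le {x : Fin n → ℤ} (hx : FourTerm x) : ∑ i, |x i| ≤ 4 := by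
  obtain ⟨α, β, γ, δ, -, -, -, rfl⟩ := hx
  have hs (m : Fin n) : ∑ i, |(Pi.single m (1 : ℤ) : Fin n → ℤ) i| = 1 := by
    rw [Finset.sum_eq_single m] <;> simp +contextual
  calc _ ≤ ∑ i, (|(Pi.single α (1 : ℤ) : Fin n → ℤ) i| + |(Pi.single β (1 : ℤ) : Fin n → ℤ) i| +
        |(Pi.single γ (1 : ℤ) : Fin n → ℤ) i| + |(Pi.single δ (1 : ℤ) : Fin n → ℤ) i|) :=
        Finset.sum_le_sum fun i _ ↦ (abs_sub _ _).trans <| by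
          gcongr
          exact (abs_add_le _ _).trans (by gcongr; exact abs_sub _ _)
    _ = 4 := by simp only [Finset.sum_add_distrib, hs]; norm_num

lemma two_mul_abs_le_sum_abs {w : Fin n → ℤ} (h0 : ∑ i, w i = 0) (k : Fin n) :
    2 * |w k| ≤ ∑ i, |w i| := by
  rw [← Finset.add_sum_erase _ _ (Finset.mem_univ k)] at h0 ⊢
  have h1 := Finset.abs_sum_le_sum_abs w (Finset.univ.erase k)
  rw [show ∑ i ∈ Finset.univ.erase k, w i = -w k by linarith, abs_neg] at h1
  linarith

lemma eq_single_sub_single_of_sum_abs_lt_four {v : Fin n → ℤ} (h0 : ∑ i, v i = 0)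
    (hv : v ≠ 0) (h4 : ∑ i, |v i| < 4) :
    ∃ i j, i ≠ j ∧ v = Pi.single i 1 - Pi.single j 1 := by
  obtain ⟨m, hm⟩ := Function.ne_iff.1 hv
  obtain ⟨i, -, hi⟩ := Finset.exists_pos_of_sum_zero_of_exists_nonzero v h0
    ⟨m, Finset.mem_univ m, hm⟩
  obtain ⟨j, -, hj⟩ := Finset.exists_pos_of_sum_zero_of_exists_nonzero (fun i ↦ -v i)
    (by simp [h0]) ⟨m, Finset.mem_univ m, by simpa using hm⟩
  have hij : i ≠ j := by rintro rfl; linarith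
  refine ⟨i, j, hij, ?_⟩
  rw [← sub_eq_zero]
  set w := v - (Pi.single i 1 - Pi.single j 1) with hw
  have hw0 : ∑ k, w k = 0 := by simp [hw, h0]
  have hwabs (k : Fin n) : |w k| = |v k| - (Pi.single i (1 : ℤ) : Fin n → ℤ) k
      - (Pi.single j (1 : ℤ) : Fin n → ℤ) k := by
    simp only [hw, Pi.sub_apply, Pi.single_apply]
    split_ifs <;> subst_vars <;> grind
  have hwsum : ∑ k, |w k| < 2 := by
    simp only [hwabs, Finset.sum_sub_distrib, Finset.sum_pi_single', Finset.mem_univ, if_true]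
    linarith
  ext k
  have := two_mul_abs_le_sum_abs hw0 k
  exact abs_eq_zero.1 (by have := abs_nonneg (w k); omega)

/-- If every pair of independent coordinates is separated by a four-term vector of `Λ`, then `Λ`
contains two independent four-term vectors with intersecting supports. -/
lemma exists_independent_fourTerm {Λ : AddSubgroup (Fin n → ℤ)}
    (hsum : ∀ v ∈ Λ, ∑ i, v i = 0) (hcoord : ∀ i, ∃ v ∈ Λ, v i ≠ 0)
    (hfour : ∀ u ∈ Λ, ∀ v ∈ Λ, ∀ i j, u i * v j ≠ u j * v i →
      ∃ t ∈ Λ, FourTerm t ∧ 0 < t i ∧ t j < 0)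
    {u v : Fin n → ℤ} (hu : u ∈ Λ) (hv : v ∈ Λ) {i j : Fin n} (hij : u i * v j ≠ u j * v i) :
    ∃ x ∈ Λ, ∃ y ∈ Λ, FourTerm x ∧ FourTerm y ∧ (∃ k, x k ≠ 0 ∧ y k ≠ 0) ∧
      ∃ k l, x k * y l ≠ x l * y k := by
  by_contra! hcon
  obtain ⟨t, ht, ht4, hti, htj⟩ := hfour u hu v hv i j hij
  have hprop (s : Fin n → ℤ) (hs : s ∈ Λ) (hs4 : FourTerm s) (k : Fin n) (htk : t k ≠ 0)
      (hsk : s k ≠ 0) (a b : Fin n) : t a * s b = t b * s a :=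
    hcon t ht s hs ht4 hs4 ⟨k, htk, hsk⟩ a b
  have hfull (k : Fin n) : t k ≠ 0 := by
    intro htk
    have hdep (m : Fin n) (hm : t m ≠ 0) : ∀ p ∈ Λ, ∀ q ∈ Λ, p m * q k = p k * q m := by
      by_contra! hpq
      obtain ⟨p, hp, q, hq, hne⟩ := hpq
      obtain ⟨s, hs, hs4, hsm, hsk⟩ := hfour p hp q hq m k hne
      have := hprop s hs hs4 m hm hsm.ne' m k
      rw [htk, zero_mul] at this
      exact mul_ne_zero hm hsk.ne this
    obtain ⟨w, hw, hwk⟩ := hcoord k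
    have h1 := hdep i hti.ne' t ht w hw
    rw [htk, zero_mul] at h1
    exact mul_ne_zero hti.ne' hwk h1
  have hsign (k l : Fin n) (hkl : 0 < t k * t l) :
      ∀ p ∈ Λ, ∀ q ∈ Λ, p k * q l = p l * q k := by
    by_contra! hpq
    obtain ⟨p, hp, q, hq, hne⟩ := hpq
    obtain ⟨s, hs, hs4, hsk, hsl⟩ := hfour p hp q hq k l hne
    have := hprop s hs hs4 k (hfull k) hsk.ne' k l
    have hk : t k * t k * s l = t k * t l * s k := by linear_combination t k * this
    linarith [mul_pos hkl hsk, mul_neg_of_pos_of_neg (mul_self_pos.2 (hfull k)) hsl]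
  let P : Finset (Fin n) := Finset.univ.filter fun k ↦ 0 < t k
  have hsplit (w : Fin n → ℤ) (hw : w ∈ Λ) : ∑ k ∈ Pᶜ, w k = -∑ k ∈ P, w k := by
    have := Finset.sum_add_sum_compl P w
    rw [hsum w hw] at this
    linarith
  have hi (w : Fin n → ℤ) (hw : w ∈ Λ) : (∑ k ∈ P, t k) * w i = t i * ∑ k ∈ P, w k := by
    rw [Finset.sum_mul, Finset.mul_sum]
    exact Finset.sum_congr rfl fun k hk ↦
      hsign k i (mul_pos (Finset.mem_filter.1 hk).2 hti) _ ht _ hw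
  have hj (w : Fin n → ℤ) (hw : w ∈ Λ) : (∑ k ∈ P, t k) * w j = t j * ∑ k ∈ P, w k := by
    have : (∑ k ∈ Pᶜ, t k) * w j = t j * ∑ k ∈ Pᶜ, w k := by
      rw [Finset.sum_mul, Finset.mul_sum]
      refine Finset.sum_congr rfl fun k hk ↦ ?_
      have htk : t k < 0 := lt_of_le_of_ne (by simpa [P] using hk) (hfull k)
      exact hsign k j (mul_pos_of_neg_of_neg htk htj) _ ht _ hw
    rw [hsplit t ht, hsplit w hw] at this
    linarith
  have hT : 0 < ∑ k ∈ P, t k :=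
    Finset.sum_pos (fun k hk ↦ (Finset.mem_filter.1 hk).2) ⟨i, by simp [P, hti]⟩
  apply hij
  refine mul_left_cancel₀ (mul_pos hT hT).ne' ?_
  calc _ = ((∑ k ∈ P, t k) * u i) * ((∑ k ∈ P, t k) * v j) := by ring
    _ = ((∑ k ∈ P, t k) * u j) * ((∑ k ∈ P, t k) * v i) := by
      rw [hi u hu, hj v hv, hj u hu, hi v hv]; ring
    _ = _ := by ring

lemma exists_minor_ne_zero_of_finrank_eq_two {Λ : AddSubgroup (Fin n → ℤ)}
    (hrank : Module.finrank ℤ (AddSubgroup.toIntSubmodule Λ) = 2) :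
    ∃ u ∈ Λ, ∃ v ∈ Λ, ∃ i j, u i * v j ≠ u j * v i := by
  by_contra! hcon
  let b := Module.finBasisOfFinrankEq ℤ (AddSubgroup.toIntSubmodule Λ) hrank
  have hli := b.linearIndependent
  obtain ⟨i, hi⟩ : ∃ i, (b 0).1 i ≠ 0 := by
    by_contra! h0
    exact b.ne_zero 0 (Subtype.ext (funext h0))
  rw [Fintype.linearIndependent_iff] at hli
  have h := hli ![(b 1).1 i, -(b 0).1 i] (by
    ext j
    have := hcon _ (b 0).2 _ (b 1).2 i j
    simp only [Fin.sum_univ_two, Matrix.cons_val_zero, Matrix.cons_val_one, Submodule.coe_add,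
      Submodule.coe_smul, Pi.add_apply, Pi.smul_apply, smul_eq_mul, ZeroMemClass.coe_zero,
      Pi.zero_apply]
    linarith) 1
  exact hi (by simpa using h)

lemma exists_smul_eq_of_finrank_eq_two {Λ : AddSubgroup (Fin n → ℤ)}
    (hrank : Module.finrank ℤ (AddSubgroup.toIntSubmodule Λ) = 2)
    {x y v : Fin n → ℤ} (hx : x ∈ Λ) (hy : y ∈ Λ) (hv : v ∈ Λ)
    {k l : Fin n} (hxy : x k * y l ≠ x l * y k) :
    ∃ N a b : ℤ, 0 < N ∧ N • v = a • x + b • y := by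
  have hnot : ¬ LinearIndependent ℤ
      (![⟨v, hv⟩, ⟨x, hx⟩, ⟨y, hy⟩] : Fin 3 → AddSubgroup.toIntSubmodule Λ) := by
    intro hli
    have := hli.fintype_card_le_finrank
    rw [hrank] at this
    simp at this
  obtain ⟨g, hg, m, hm⟩ := Fintype.not_linearIndependent_iff.1 hnot
  have hg' : g 0 • v + g 1 • x + g 2 • y = 0 := by
    simpa [Fin.sum_univ_three] using congrArg Subtype.val hg
  have hg0 : g 0 ≠ 0 := by
    intro h0
    rw [h0, zero_smul, zero_add] at hg'
    have hk : g 1 * x k + g 2 * y k = 0 := congrFun hg' k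
    have hl : g 1 * x l + g 2 * y l = 0 := congrFun hg' l
    have hd := sub_ne_zero.2 hxy
    have h1 : g 1 = 0 := (mul_eq_zero.1 (by linear_combination y l * hk - y k * hl :
      g 1 * (x k * y l - x l * y k) = 0)).resolve_right hd
    have h2 : g 2 = 0 := (mul_eq_zero.1 (by linear_combination x k * hl - x l * hk :
      g 2 * (x k * y l - x l * y k) = 0)).resolve_right hd
    fin_cases m
    exacts [hm h0, hm h1, hm h2]
  have hv' : g 0 • v = (-g 1) • x + (-g 2) • y := by
    rw [← sub_eq_zero, ← hg']
    simp only [neg_smul]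
    abel
  rcases lt_or_gt_of_ne hg0 with h | h
  · refine ⟨-g 0, g 1, g 2, neg_pos.2 h, ?_⟩
    rw [neg_smul, hv']
    simp only [neg_smul]
    abel
  · exact ⟨g 0, -g 1, -g 2, h, hv'⟩

lemma exists_two_mul_abs_sub_mul_le (a : ℤ) {N : ℤ} (hN : 0 < N) :
    ∃ q, 2 * |a - q * N| ≤ N := by
  refine ⟨(2 * a + N) / (2 * N), ?_⟩
  have h1 := Int.emod_add_mul_ediv (2 * a + N) (2 * N)
  have h2 := Int.emod_nonneg (2 * a + N) (by omega : 2 * N ≠ 0)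
  have h3 := Int.emod_lt_of_pos (2 * a + N) (by omega : 0 < 2 * N)
  have h4 : |a - (2 * a + N) / (2 * N) * N| * 2 = |2 * (a - (2 * a + N) / (2 * N) * N)| := by
    rw [abs_mul]; norm_num [mul_comm]
  rw [mul_comm, h4, abs_le]
  constructor <;> nlinarith

lemma abs_add_abs_sub_le_of_two_mul_eq {a b w e f : ℤ} (he : e = 1 ∨ e = -1)
    (hf : f = 1 ∨ f = -1) (hw : 2 * w = e * a + f * b) :
    |w| + |w - e * a| ≤ |a| + |b| ∧ (a ≠ 0 → b ≠ 0 → |w| + |w - e * a| < |a| + |b|) := by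
  simp only [Int.abs_eq_natAbs]
  rcases he with rfl | rfl <;> rcases hf with rfl | rfl <;> omega

/-- Two independent vectors of minimal `ℓ¹`-norm with intersecting supports generate a lattice of
rank two. -/
lemma eq_closure_pair_of_sum_abs_le {Λ : AddSubgroup (Fin n → ℤ)}
    (hrank : Module.finrank ℤ (AddSubgroup.toIntSubmodule Λ) = 2)
    {c : ℤ} (hmin : ∀ v ∈ Λ, v ≠ 0 → c ≤ ∑ i, |v i|)
    {x y : Fin n → ℤ} (hx : x ∈ Λ) (hy : y ∈ Λ) (hxc : ∑ i, |x i| ≤ c) (hyc : ∑ i, |y i| ≤ c)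
    {k l m : Fin n} (hxy : x k * y l ≠ x l * y k) (hxm : x m ≠ 0) (hym : y m ≠ 0) :
    Λ = AddSubgroup.closure {x, y} := by
  refine le_antisymm (fun v hv ↦ ?_) ((AddSubgroup.closure_le Λ).2 ?_)
  swap
  · rintro _ (rfl | rfl)
    exacts [hx, hy]
  obtain ⟨N, a, b, hN, hab⟩ := exists_smul_eq_of_finrank_eq_two hrank hx hy hv hxy
  obtain ⟨q, hq⟩ := exists_two_mul_abs_sub_mul_le a hN
  obtain ⟨r, hr⟩ := exists_two_mul_abs_sub_mul_le b hN
  set R := a - q * N with hR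
  set S := b - r * N with hS
  set w := v - q • x - r • y with hw
  have hwΛ : w ∈ Λ := sub_mem (sub_mem hv (zsmul_mem hx q)) (zsmul_mem hy r)
  have hNw (i : Fin n) : N * w i = R * x i + S * y i := by
    have := congrFun hab i
    simp only [Pi.smul_apply, Pi.add_apply, smul_eq_mul] at this
    simp only [hw, hR, hS, Pi.sub_apply, Pi.smul_apply, smul_eq_mul]
    linear_combination this
  suffices hw0 : w = 0 by
    rw [show v = q • x + r • y by rw [← sub_eq_zero, ← hw0, hw]; abel]
    exact add_mem (zsmul_mem (AddSubgroup.subset_closure (by simp)) q)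
      (zsmul_mem (AddSubgroup.subset_closure (by simp)) r)
  by_contra hw0
  have hcw := hmin w hwΛ hw0
  have hc : 0 < c := lt_of_lt_of_le (abs_pos.2 hxm)
    ((Finset.single_le_sum (fun i _ ↦ abs_nonneg (x i)) (Finset.mem_univ m)).trans hxc)
  have hle : N * ∑ i, |w i| ≤ |R| * c + |S| * c := by
    calc N * ∑ i, |w i| = ∑ i, |R * x i + S * y i| := by
          simp only [← hNw, abs_mul, abs_of_pos hN, Finset.mul_sum]
      _ ≤ ∑ i, (|R| * |x i| + |S| * |y i|) := Finset.sum_le_sum fun i _ ↦ by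
          simpa only [abs_mul] using abs_add_le (R * x i) (S * y i)
      _ ≤ |R| * c + |S| * c := by
          rw [Finset.sum_add_distrib, ← Finset.mul_sum, ← Finset.mul_sum]
          gcongr
  have hN_le : N ≤ |R| + |S| := by
    refine le_of_mul_le_mul_right ?_ hc
    nlinarith [mul_le_mul_of_nonneg_left hcw hN.le]
  have hsgn (T : ℤ) (hT : 2 * |T| = N) : ∃ e : ℤ, (e = 1 ∨ e = -1) ∧ 2 * T = e * N := by
    rcases abs_choice T with h | h
    · exact ⟨1, Or.inl rfl, by linarith⟩
    · exact ⟨-1, Or.inr rfl, by linarith⟩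
  obtain ⟨e, he, hRe⟩ := hsgn R (by linarith)
  obtain ⟨f, hf, hSf⟩ := hsgn S (by linarith)
  have h2w (i : Fin n) : 2 * w i = e * x i + f * y i :=
    mul_left_cancel₀ hN.ne' (by linear_combination 2 * hNw i + x i * hRe + y i * hSf)
  have hw' : w - e • x ≠ 0 := by
    intro h
    have hxy' (i : Fin n) : e * x i = f * y i := by
      have h1 := congrFun h i
      simp only [Pi.sub_apply, Pi.smul_apply, smul_eq_mul, Pi.zero_apply] at h1
      linarith [h2w i]
    apply hxy
    have hk := hxy' k
    have hl := hxy' l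
    rcases he with rfl | rfl <;> rcases hf with rfl | rfl <;> grind
  have hcw' := hmin _ (sub_mem hwΛ (zsmul_mem hx e)) hw'
  have hlt : ∑ i, (|w i| + |(w - e • x) i|) < ∑ i, (|x i| + |y i|) := by
    have hi (i : Fin n) := abs_add_abs_sub_le_of_two_mul_eq he hf (h2w i)
    exact Finset.sum_lt_sum (fun i _ ↦ (hi i).1) ⟨m, Finset.mem_univ m, (hi m).2 hxm hym⟩
  rw [Finset.sum_add_distrib, Finset.sum_add_distrib] at hlt
  linarith

lemma exists_mem_latticeOf_apply_ne_zero {B : Set (Fin n → ℤ)} (hbpf : Basepointfree B)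
    (hconc : Concise B) (i : Fin n) : ∃ v ∈ latticeOf B, v i ≠ 0 := by
  obtain ⟨v, hv, hvi⟩ := hbpf i
  obtain ⟨w, hw, hwi⟩ := hconc i
  exact ⟨w - v, AddSubgroup.subset_closure ⟨w, hw, v, hv, rfl⟩, by simpa [hvi] using hwi⟩

lemma sum_eq_zero_of_mem_latticeOf {d : ℕ} {B : Set (Fin n → ℤ)} (hB : B ⊆ Delta n d)
    {v : Fin n → ℤ} (hv : v ∈ latticeOf B) : ∑ i, v i = 0 := by
  induction hv using AddSubgroup.closure_induction with
  | mem x hx =>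
    obtain ⟨v, hv, w, hw, rfl⟩ := hx
    simp [(hB hv).2, (hB hw).2]
  | zero => simp
  | add x y _ _ hx hy => simp [Finset.sum_add_distrib, hx, hy]
  | neg x _ hx => simp [hx]

end SecantLattice

theorem statement_9 (K : Type*) [Field K] [IsAlgClosed K] [CharZero K]
    (d ℓ : ℕ) (hd : 1 ≤ d) (hl : 2 ≤ ℓ)
    (B : Set (Fin (ℓ + 1) → ℤ))
    (hBΔ : B ⊆ Delta (ℓ + 1) d)
    (hbpf : Basepointfree B)
    (hconc : Concise B)
    (hrank : Module.finrank ℤ (AddSubgroup.toIntSubmodule (latticeOf B)) = 2)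
    (hne : ∀ i j : Fin (ℓ + 1), i ≠ j →
      (Pi.single i 1 - Pi.single j 1 : Fin (ℓ + 1) → ℤ) ∉ latticeOf B)
    (hsec : SecantCondition K (latticeOf B)) :
    ∃ x y : Fin (ℓ + 1) → ℤ, FourTerm x ∧ FourTerm y ∧
      (∃ i, x i ≠ 0 ∧ y i ≠ 0) ∧
      latticeOf B = AddSubgroup.closure {x, y} := by
  have hsum : ∀ v ∈ latticeOf B, ∑ i, v i = 0 := fun v hv ↦ sum_eq_zero_of_mem_latticeOf hBΔ hv
  obtain ⟨u, hu, v, hv, i, j, hij⟩ := exists_minor_ne_zero_of_finrank_eq_two hrank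
  obtain ⟨x, hx, y, hy, hx4, hy4, ⟨m, hxm, hym⟩, k, l, hkl⟩ :=
    exists_independent_fourTerm hsum (exists_mem_latticeOf_apply_ne_zero hbpf hconc)
      (fun u hu v hv i j hij ↦ hsec.exists_fourTerm hne hu hv hij) hu hv hij
  refine ⟨x, y, hx4, hy4, ⟨m, hxm, hym⟩, eq_closure_pair_of_sum_abs_le hrank (c := 4) ?_ hx hy
    hx4.sum_abs_le hy4.sum_abs_le hkl hxm hym⟩
  intro w hw hw0
  by_contra! hlt
  obtain ⟨a, b, hab, rfl⟩ := eq_single_sub_single_of_sum_abs_lt_four (hsum w hw) hw0 hlt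
  exact hne a b hab hw
end

section
/- Let d ≤ 3 and ℓ ≥ 0 be natural numbers with d ≥ 1, and let B ⊆ Δ_ℓ(d) be a basepoint-free and concise subset with exactly three elements such that e_α − e_β ∉ ⟨B⟩ for all α ≠ β. Then: (a) there is no index k and element v ∈ B with v_k = 0 such that every other element v′ ∈ B satisfies v′_k ≥ 2 (that is, B is not cuspidal); and (b) there are no indices i ≠ j and element v ∈ B with v_i = v_j = 0 such that every other element v′ ∈ B satisfies v′_i > 0 and v′_j > 0 (that is, B has no marked node). (This is the combinatorial content of the paper's lemma that for such B the center of projection intersects no marked secants and no tangent lines of the rational normal curve.) -/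
/-- A nonnegative integer vector with positive entry sum at most one is a standard basis vector. -/
theorem exists_eq_single_of_sum_le_one {n : ℕ} {u : Fin n → ℤ} (hu : ∀ i, 0 ≤ u i)
    (hs : ∑ i, u i ≤ 1) (h0 : u ≠ 0) : ∃ p, u = Pi.single p 1 := by
  obtain ⟨p, hp⟩ := Function.ne_iff.mp h0
  have hp1 : 1 ≤ u p := by
    have := hu p
    simp only [Pi.zero_apply] at hp
    omega
  have hnn : ∀ i, 0 ≤ (u - Pi.single p 1 : Fin n → ℤ) i := by
    intro i
    by_cases h : i = p
    · subst h
      simpa using hp1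
    · simpa [h] using hu i
  have hsum : ∑ i, (u - Pi.single p 1 : Fin n → ℤ) i ≤ 0 := by
    simp only [Pi.sub_apply, Finset.sum_sub_distrib, Finset.sum_pi_single', Finset.mem_univ,
      if_true]
    linarith
  have hz := (Finset.sum_eq_zero_iff_of_nonneg fun i _ => hnn i).mp
    (le_antisymm hsum (Finset.sum_nonneg fun i _ => hnn i))
  exact ⟨p, sub_eq_zero.mp (funext fun i => hz i (Finset.mem_univ i))⟩

/-- Two distinct points of `Delta n d` dominating a common vector of degree at least `d - 1`
differ by a difference of standard basis vectors. -/
theorem exists_sub_eq_single_sub_single {n d : ℕ} {a b w : Fin n → ℤ} (ha : a ∈ Delta n d)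
    (hb : b ∈ Delta n d) (hwa : w ≤ a) (hwb : w ≤ b) (hw : (d : ℤ) ≤ ∑ i, w i + 1)
    (hab : a ≠ b) : ∃ p q, p ≠ q ∧ a - b = Pi.single p 1 - Pi.single q 1 := by
  have hnn : ∀ c : Fin n → ℤ, w ≤ c → ∀ i, 0 ≤ (c - w) i := fun c hc i => sub_nonneg.mpr (hc i)
  have hsum : ∀ c ∈ Delta n d, ∑ i, (c - w) i = d - ∑ i, w i := by
    intro c hc
    simp only [Pi.sub_apply, Finset.sum_sub_distrib, hc.2]
  have hne : ∀ c ∈ Delta n d, ∀ c' ∈ Delta n d, w ≤ c' → c ≠ c' → c - w ≠ 0 := by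
    intro c hc c' hc' hwc' hcc' h
    have hd : ∑ i, (c' - w) i = 0 := by
      rw [hsum c' hc', ← hsum c hc, h]
      simp
    have hz := (Finset.sum_eq_zero_iff_of_nonneg fun i _ => hnn c' hwc' i).mp hd
    have h' : c' - w = 0 := funext fun i => hz i (Finset.mem_univ i)
    exact hcc' ((sub_eq_zero.mp h).trans (sub_eq_zero.mp h').symm)
  obtain ⟨p, hp⟩ := exists_eq_single_of_sum_le_one (hnn a hwa)
    (by rw [hsum a ha]; linarith) (hne a ha b hb hwb hab)
  obtain ⟨q, hq⟩ := exists_eq_single_of_sum_le_one (hnn b hwb)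
    (by rw [hsum b hb]; linarith) (hne b hb a ha hwa hab.symm)
  refine ⟨p, q, ?_, ?_⟩
  · rintro rfl
    exact hab (sub_left_injective (hp.trans hq.symm))
  · rw [← hp, ← hq, sub_sub_sub_cancel_right]

/-- If `⟨B⟩` contains no difference of distinct basis vectors and `d ≤ 3`, then two distinct
elements of `B` cannot both dominate `e_i + e_j`. -/
theorem not_single_add_single_le {n d : ℕ} (hd : d ≤ 3) {B : Set (Fin n → ℤ)}
    (hB : B ⊆ Delta n d)
    (hne : ∀ α β : Fin n, α ≠ β →
      (Pi.single α 1 - Pi.single β 1 : Fin n → ℤ) ∉ latticeOf B)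
    {a b : Fin n → ℤ} (ha : a ∈ B) (hb : b ∈ B) (hab : a ≠ b) (i j : Fin n)
    (hwa : (Pi.single i 1 + Pi.single j 1 : Fin n → ℤ) ≤ a)
    (hwb : (Pi.single i 1 + Pi.single j 1 : Fin n → ℤ) ≤ b) : False := by
  obtain ⟨p, q, hpq, h⟩ := exists_sub_eq_single_sub_single (hB ha) (hB hb) hwa hwb
    (by
      simp only [Pi.add_apply, Finset.sum_add_distrib, Finset.sum_pi_single', Finset.mem_univ, if_true]
      omega) hab
  exact hne p q hpq (h ▸ AddSubgroup.subset_closure ⟨a, ha, b, hb, rfl⟩)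

theorem statement_11 (d ℓ : ℕ) (hd1 : 1 ≤ d) (hd3 : d ≤ 3)
    (B : Set (Fin (ℓ + 1) → ℤ))
    (hBΔ : B ⊆ Delta (ℓ + 1) d)
    (hbpf : Basepointfree B)
    (hconc : Concise B)
    (hcard : B.ncard = 3)
    (hne : ∀ α β : Fin (ℓ + 1), α ≠ β →
      (Pi.single α 1 - Pi.single β 1 : Fin (ℓ + 1) → ℤ) ∉ latticeOf B) :
    (¬ ∃ (k : Fin (ℓ + 1)) (v : Fin (ℓ + 1) → ℤ), v ∈ B ∧ v k = 0 ∧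
        ∀ v' ∈ B, v' ≠ v → 2 ≤ v' k) ∧
    (¬ ∃ (i j : Fin (ℓ + 1)) (v : Fin (ℓ + 1) → ℤ), i ≠ j ∧ v ∈ B ∧
        v i = 0 ∧ v j = 0 ∧ ∀ v' ∈ B, v' ≠ v → 0 < v' i ∧ 0 < v' j) := by
  have hpair : ∀ v ∈ B, ∃ a ∈ B, ∃ b ∈ B, a ≠ v ∧ b ≠ v ∧ a ≠ b := by
    intro v hv
    have hfin : B.Finite := Set.finite_of_ncard_ne_zero (by omega)
    have h1 : 1 < (B \ {v}).ncard := by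
      rw [Set.ncard_sdiff_singleton_of_mem hv]
      omega
    obtain ⟨a, b, ha, hb, hab⟩ := (Set.one_lt_ncard_iff (hfin.subset Set.sdiff_subset)).mp h1
    exact ⟨a, ha.1, b, hb.1, ha.2, hb.2, hab⟩
  constructor
  · rintro ⟨k, v, hv, -, h⟩
    obtain ⟨a, ha, b, hb, hav, hbv, hab⟩ := hpair v hv
    have hle : ∀ c ∈ B, c ≠ v → (Pi.single k 1 + Pi.single k 1 : Fin (ℓ + 1) → ℤ) ≤ c := by
      intro c hc hcv m
      have h0 := (hBΔ hc).1 m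
      have h2 := h c hc hcv
      simp only [Pi.add_apply, Pi.single_apply]
      split_ifs with hm
      · subst hm
        omega
      · omega
    exact not_single_add_single_le hd3 hBΔ hne ha hb hab k k (hle a ha hav) (hle b hb hbv)
  · rintro ⟨i, j, v, hij, hv, -, -, h⟩
    obtain ⟨a, ha, b, hb, hav, hbv, hab⟩ := hpair v hv
    have hle : ∀ c ∈ B, c ≠ v → (Pi.single i 1 + Pi.single j 1 : Fin (ℓ + 1) → ℤ) ≤ c := by
      intro c hc hcv m
      have h0 := (hBΔ hc).1 m
      have h2 := h c hc hcv
      simp only [Pi.add_apply, Pi.single_apply]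
      split_ifs with hmi hmj hmj
      · exact absurd (hmi.symm.trans hmj) hij
      · subst hmi
        omega
      · subst hmj
        omega
      · omega
    exact not_single_add_single_le hd3 hBΔ hne ha hb hab i j (hle a ha hav) (hle b hb hbv)
end

section
/- Let ℓ ≥ 2 and let B ⊆ Δ_ℓ(2) be a basepoint-free and concise subset with exactly three elements such that ⟨B⟩ has rank 2 and e_i − e_j ∉ ⟨B⟩ for all i ≠ j. Then ℓ ≤ 5, and there exists a permutation σ of {0,…,ℓ} such that the image of ⟨B⟩ under the coordinate permutation of ℤ^{ℓ+1} induced by σ equals one of the five Table 1 lattices (necessarily the one whose ambient lattice is ℤ^{ℓ+1}). -/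
/-- The vector in `ℤ^n` whose `i`-th entry is the `i`-th entry of the list `l`
(or `0` if the list is too short). -/
def tVec {n : ℕ} (l : List ℤ) : Fin n → ℤ := fun i => l.getD i.val 0

/-- `Λ ⊆ ℤ^n` is (equal to) one of the five exceptional lattices of
Table 1 of the paper. -/
def IsTableLattice {n : ℕ} (Λ : AddSubgroup (Fin n → ℤ)) : Prop :=
  (n = 6 ∧ Λ = AddSubgroup.closure {tVec [1, 1, -1, -1, 0, 0], tVec [1, 1, 0, 0, -1, -1]}) ∨
  (n = 5 ∧ Λ = AddSubgroup.closure {tVec [2, -1, -1, 0, 0], tVec [2, 0, 0, -1, -1]}) ∨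
  (n = 4 ∧ Λ = AddSubgroup.closure {tVec [2, -2, 0, 0], tVec [2, 0, -1, -1]}) ∨
  (n = 3 ∧ Λ = AddSubgroup.closure {tVec [2, -2, 0], tVec [2, 0, -2]}) ∨
  (n = 3 ∧ Λ = AddSubgroup.closure {tVec [2, -2, 0], tVec [2, -1, -1]})

/-- The additive automorphism of `ℤ^n` permuting coordinates according to `σ`. -/
def permMap {n : ℕ} (σ : Equiv.Perm (Fin n)) : (Fin n → ℤ) →+ (Fin n → ℤ) where
  toFun v := v ∘ σ
  map_zero' := rfl
  map_add' _ _ := rfl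

/-- The vector `e_i + e_j`. -/
def edgeVec {n : ℕ} (i j : Fin n) : Fin n → ℤ := Pi.single i 1 + Pi.single j 1

theorem edgeVec_comm {n : ℕ} (i j : Fin n) : edgeVec i j = edgeVec j i := add_comm _ _

theorem eq_or_eq_of_edgeVec_apply_ne_zero {n : ℕ} {i j x : Fin n} (h : edgeVec i j x ≠ 0) :
    x = i ∨ x = j := by
  by_contra! hx
  exact h (by simp [edgeVec, hx.1, hx.2])

/-- A vector of `Delta n (d + 1)` is a vector of `Delta n d` plus a unit vector. -/
theorem exists_sub_single_mem_Delta {n d : ℕ} {u : Fin n → ℤ} (hu : u ∈ Delta n (d + 1)) :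
    ∃ i, u - Pi.single i 1 ∈ Delta n d := by
  obtain ⟨h0, hs⟩ := hu
  have hpos : ∃ i ∈ Finset.univ, (0 : ℤ) < u i := by
    apply Finset.exists_lt_of_sum_lt
    rw [hs]
    simp
  obtain ⟨i, -, hi⟩ := hpos
  refine ⟨i, fun j => ?_, ?_⟩
  · by_cases hj : j = i
    · subst hj
      simp only [Pi.sub_apply, Pi.single_eq_same]
      omega
    · simpa [hj] using h0 j
  · simp [Finset.sum_sub_distrib, hs]

theorem eq_edgeVec_of_mem_Delta_two {n : ℕ} {u : Fin n → ℤ} (hu : u ∈ Delta n 2) :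
    ∃ i j, u = edgeVec i j := by
  obtain ⟨i, hi⟩ := exists_sub_single_mem_Delta hu
  obtain ⟨j, h0, hs⟩ := exists_sub_single_mem_Delta hi
  refine ⟨i, j, ?_⟩
  have hz := (Finset.sum_eq_zero_iff_of_nonneg fun k _ => h0 k).1 hs
  ext k
  have := hz k (Finset.mem_univ k)
  simp only [Pi.sub_apply] at this
  simp only [edgeVec, Pi.add_apply]
  omega

theorem ne_of_edgeVec_mem {n : ℕ} {B : Set (Fin n → ℤ)}
    (hne : ∀ i j : Fin n, i ≠ j → (Pi.single i 1 - Pi.single j 1 : Fin n → ℤ) ∉ latticeOf B)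
    {i j k l : Fin n} (h₁ : edgeVec i j ∈ B) (h₂ : edgeVec k l ∈ B)
    (h : edgeVec i j ≠ edgeVec k l) : i ≠ k := by
  rintro rfl
  have hjl : j ≠ l := fun e => h (by rw [e])
  exact hne j l hjl (AddSubgroup.subset_closure
    ⟨_, h₁, _, h₂, (add_sub_add_left_eq_sub _ _ _).symm⟩)

theorem latticeOf_triple {n : ℕ} (a b c : Fin n → ℤ) :
    latticeOf {a, b, c} = AddSubgroup.closure {a - b, a - c} := by
  have hb : a - b ∈ AddSubgroup.closure {a - b, a - c} :=
    AddSubgroup.subset_closure (by simp)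
  have hc : a - c ∈ AddSubgroup.closure {a - b, a - c} :=
    AddSubgroup.subset_closure (by simp)
  have key : ∀ v ∈ ({a, b, c} : Set (Fin n → ℤ)),
      a - v ∈ AddSubgroup.closure {a - b, a - c} := by
    rintro v (rfl | rfl | rfl)
    · simp
    · exact hb
    · exact hc
  apply le_antisymm
  · rw [latticeOf, AddSubgroup.closure_le]
    rintro _ ⟨v, hv, w, hw, rfl⟩
    simpa using sub_mem (key w hw) (key v hv)
  · rw [AddSubgroup.closure_le]
    rintro _ (rfl | rfl)
    · exact AddSubgroup.subset_closure ⟨a, by simp, b, by simp, rfl⟩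
    · exact AddSubgroup.subset_closure ⟨a, by simp, c, by simp, rfl⟩

theorem permMap_edgeVec {n : ℕ} (σ : Equiv.Perm (Fin n)) (p q : Fin n) :
    permMap σ (edgeVec (σ p) (σ q)) = edgeVec p q := by
  ext k
  simp [permMap, edgeVec, Pi.single_apply]

theorem map_permMap_latticeOf {n : ℕ} (σ : Equiv.Perm (Fin n)) (p q r s t u : Fin n) :
    (latticeOf {edgeVec (σ p) (σ q), edgeVec (σ r) (σ s), edgeVec (σ t) (σ u)}).map (permMap σ) =
      AddSubgroup.closure {edgeVec p q - edgeVec r s, edgeVec p q - edgeVec t u} := by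
  rw [latticeOf_triple, AddMonoidHom.map_closure, Set.image_pair]
  simp only [map_sub, permMap_edgeVec]

/-- If `f` enumerates the coordinates, the lattice of a triple of vectors `e_i + e_j` can be
read off in the enumerated coordinates. -/
theorem exists_perm_of_bijective {m n : ℕ} (f : Fin m → Fin n) (hf : Function.Bijective f)
    (p q r s t u : Fin m) (hm : m ≤ 6)
    (hT : IsTableLattice
      (AddSubgroup.closure {edgeVec p q - edgeVec r s, edgeVec p q - edgeVec t u})) :
    n ≤ 6 ∧ ∃ σ : Equiv.Perm (Fin n), IsTableLattice ((latticeOf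
      {edgeVec (f p) (f q), edgeVec (f r) (f s), edgeVec (f t) (f u)}).map (permMap σ)) := by
  obtain rfl : m = n := by simpa using Fintype.card_of_bijective hf
  refine ⟨hm, Equiv.ofBijective f hf, ?_⟩
  have := map_permMap_latticeOf (Equiv.ofBijective f hf) p q r s t u
  simp only [Equiv.ofBijective_apply] at this
  rwa [this]

theorem exists_perm_of_no_loops {n : ℕ} {i j k l m o : Fin n} (hnd : [i, j, k, l, m, o].Nodup)
    (hcov : ∀ x, x ∈ [i, j, k, l, m, o]) :
    n ≤ 6 ∧ ∃ σ : Equiv.Perm (Fin n), IsTableLattice ((latticeOf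
      {edgeVec i j, edgeVec k l, edgeVec m o}).map (permMap σ)) := by
  refine exists_perm_of_bijective (m := 6) [i, j, k, l, m, o].get
    ⟨List.nodup_iff_injective_get.1 hnd, fun x => List.mem_iff_get.1 (hcov x)⟩
    0 1 2 3 4 5 (by simp) (Or.inl ⟨rfl, ?_⟩)
  congr 2
  · decide
  · exact congrArg singleton (by decide)

theorem exists_perm_of_one_loop {n : ℕ} {i k l m o : Fin n} (hnd : [i, k, l, m, o].Nodup)
    (hcov : ∀ x, x ∈ [i, k, l, m, o]) :
    n ≤ 6 ∧ ∃ σ : Equiv.Perm (Fin n), IsTableLattice ((latticeOf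
      {edgeVec i i, edgeVec k l, edgeVec m o}).map (permMap σ)) := by
  refine exists_perm_of_bijective (m := 5) [i, k, l, m, o].get
    ⟨List.nodup_iff_injective_get.1 hnd, fun x => List.mem_iff_get.1 (hcov x)⟩
    0 0 1 2 3 4 (by simp) (Or.inr <| Or.inl ⟨rfl, ?_⟩)
  congr 2
  · decide
  · exact congrArg singleton (by decide)

theorem exists_perm_of_two_loops {n : ℕ} {i k m o : Fin n} (hnd : [i, k, m, o].Nodup)
    (hcov : ∀ x, x ∈ [i, k, m, o]) :
    n ≤ 6 ∧ ∃ σ : Equiv.Perm (Fin n), IsTableLattice ((latticeOf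
      {edgeVec i i, edgeVec k k, edgeVec m o}).map (permMap σ)) := by
  refine exists_perm_of_bijective (m := 4) [i, k, m, o].get
    ⟨List.nodup_iff_injective_get.1 hnd, fun x => List.mem_iff_get.1 (hcov x)⟩
    0 0 1 1 2 3 (by simp) (Or.inr <| Or.inr <| Or.inl ⟨rfl, ?_⟩)
  congr 2
  · decide
  · exact congrArg singleton (by decide)

theorem exists_perm_of_three_loops {n : ℕ} {i k m : Fin n} (hnd : [i, k, m].Nodup)
    (hcov : ∀ x, x ∈ [i, k, m]) :
    n ≤ 6 ∧ ∃ σ : Equiv.Perm (Fin n), IsTableLattice ((latticeOf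
      {edgeVec i i, edgeVec k k, edgeVec m m}).map (permMap σ)) := by
  refine exists_perm_of_bijective (m := 3) [i, k, m].get
    ⟨List.nodup_iff_injective_get.1 hnd, fun x => List.mem_iff_get.1 (hcov x)⟩
    0 0 1 1 2 2 (by simp) (Or.inr <| Or.inr <| Or.inr <| Or.inl ⟨rfl, ?_⟩)
  congr 2
  · decide
  · exact congrArg singleton (by decide)

theorem statement_12 (ℓ : ℕ) (hl : 2 ≤ ℓ)
    (B : Set (Fin (ℓ + 1) → ℤ))
    (hBΔ : B ⊆ Delta (ℓ + 1) 2)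
    (hbpf : Basepointfree B)
    (hconc : Concise B)
    (hcard : B.ncard = 3)
    (hrank : Module.finrank ℤ (AddSubgroup.toIntSubmodule (latticeOf B)) = 2)
    (hne : ∀ i j : Fin (ℓ + 1), i ≠ j →
      (Pi.single i 1 - Pi.single j 1 : Fin (ℓ + 1) → ℤ) ∉ latticeOf B) :
    ℓ ≤ 5 ∧ ∃ σ : Equiv.Perm (Fin (ℓ + 1)),
      IsTableLattice ((latticeOf B).map (permMap σ)) := by
  obtain ⟨a, b, c, hab, hac, hbc, rfl⟩ := Set.ncard_eq_three.1 hcard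
  obtain ⟨i, j, rfl⟩ := eq_edgeVec_of_mem_Delta_two (hBΔ (show a ∈ _ by simp))
  obtain ⟨k, l, rfl⟩ := eq_edgeVec_of_mem_Delta_two (hBΔ (show b ∈ _ by simp))
  obtain ⟨m, o, rfl⟩ := eq_edgeVec_of_mem_Delta_two (hBΔ (show c ∈ _ by simp))
  have hcov : ∀ x, x = i ∨ x = j ∨ x = k ∨ x = l ∨ x = m ∨ x = o := by
    intro x
    obtain ⟨v, (rfl | rfl | rfl), hv⟩ := hconc x <;>
      have := eq_or_eq_of_edgeVec_apply_ne_zero hv <;> tauto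
  have disj : ∀ {p q r s : Fin (ℓ + 1)},
      edgeVec p q ∈ ({edgeVec i j, edgeVec k l, edgeVec m o} : Set (Fin (ℓ + 1) → ℤ)) →
      edgeVec r s ∈ ({edgeVec i j, edgeVec k l, edgeVec m o} : Set (Fin (ℓ + 1) → ℤ)) →
      edgeVec p q ≠ edgeVec r s → p ≠ r ∧ p ≠ s ∧ q ≠ r ∧ q ≠ s := by
    intro p q r s h₁ h₂ h
    have h₁' := edgeVec_comm p q ▸ h₁
    have h₂' := edgeVec_comm r s ▸ h₂
    refine ⟨ne_of_edgeVec_mem hne h₁ h₂ h, ne_of_edgeVec_mem hne h₁ h₂' ?_,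
      ne_of_edgeVec_mem hne h₁' h₂ ?_, ne_of_edgeVec_mem hne h₁' h₂' ?_⟩
    · rwa [edgeVec_comm s r]
    · rwa [edgeVec_comm q p]
    · rwa [edgeVec_comm q p, edgeVec_comm s r]
  obtain ⟨h1, h2, h3, h4⟩ := disj (by simp) (by simp) hab
  obtain ⟨h5, h6, h7, h8⟩ := disj (by simp) (by simp) hac
  obtain ⟨h9, h10, h11, h12⟩ := disj (by simp) (by simp) hbc
  clear disj hne hrank hcard hconc hbpf hBΔ hab hac hbc
  suffices H : ℓ + 1 ≤ 6 ∧ ∃ σ : Equiv.Perm (Fin (ℓ + 1)), IsTableLattice ((latticeOf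
      {edgeVec i j, edgeVec k l, edgeVec m o}).map (permMap σ)) from ⟨by omega, H.2⟩
  have rot : ∀ x y z : Fin (ℓ + 1) → ℤ, ({x, y, z} : Set _) = {z, x, y} := by
    intro x y z
    rw [Set.pair_comm y z, Set.insert_comm]
  by_cases hij : i = j <;> by_cases hkl : k = l <;> by_cases hmo : m = o
  · subst hij hkl hmo
    exact exists_perm_of_three_loops (by simp; grind) (fun x => by have := hcov x; simp; tauto)
  · subst hij hkl
    exact exists_perm_of_two_loops (by simp; grind) (fun x => by have := hcov x; simp; tauto)
  · subst hij hmo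
    rw [rot]
    exact exists_perm_of_two_loops (by simp; grind) (fun x => by have := hcov x; simp; tauto)
  · subst hij
    exact exists_perm_of_one_loop (by simp; grind) (fun x => by have := hcov x; simp; tauto)
  · subst hkl hmo
    rw [rot, rot]
    exact exists_perm_of_two_loops (by simp; grind) (fun x => by have := hcov x; simp; tauto)
  · subst hkl
    rw [rot, rot]
    exact exists_perm_of_one_loop (by simp; grind) (fun x => by have := hcov x; simp; tauto)
  · subst hmo
    rw [rot]
    exact exists_perm_of_one_loop (by simp; grind) (fun x => by have := hcov x; simp; tauto)
  · exact exists_perm_of_no_loops (by simp; grind) (fun x => by have := hcov x; simp; tauto)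
end
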